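/- Let G be a 3-connected cubic (3-regular) finite simple graph and let 𝒪 be a set of pairwise edge-disjoint cycles of G. Then there exists a perfect matching (1-factor) F of G such that E(F) ∩ E(O) ≠ ∅ for every O ∈ 𝒪. -/

import Mathlib

open SimpleGraph

namespace PaperFormalization

variable {V : Type*}

/-- The degree of a vertex in a subgraph. -/
noncomputable def sdeg {G : SimpleGraph V} (H : G.Subgraph) (v : V) : ℕ :=
  (H.neighborSet v).ncard

/-- `H` is a `t`-factor of `G`: a spanning subgraph in which every vertex has degree `t`. -/
def IsTFactor {G : SimpleGraph V} (H : G.Subgraph) (t : ℕ) : Prop :=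
  H.IsSpanning ∧ ∀ v : V, sdeg H v = t

/-- A cycle of `G`: a connected 2-regular subgraph. -/
def IsCycleSG {G : SimpleGraph V} (C : G.Subgraph) : Prop :=
  C.Connected ∧ ∀ v ∈ C.verts, sdeg C v = 2

/-- An odd cycle: a cycle with an odd number of edges. -/
def IsOddCycleSG {G : SimpleGraph V} (C : G.Subgraph) : Prop :=
  IsCycleSG C ∧ Odd C.edgeSet.ncard

/-- A family of subgraphs is pairwise edge-disjoint. -/
def PairwiseEdgeDisjoint {G : SimpleGraph V} (𝒪 : Set G.Subgraph) : Prop :=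
  𝒪.Pairwise fun O₁ O₂ => Disjoint O₁.edgeSet O₂.edgeSet

/-- A family of subgraphs is pairwise vertex-disjoint. -/
def PairwiseVertexDisjoint {G : SimpleGraph V} (𝒪 : Set G.Subgraph) : Prop :=
  𝒪.Pairwise fun O₁ O₂ => Disjoint O₁.verts O₂.verts

/-- `G` is `r`-regular. -/
def IsRegular (G : SimpleGraph V) (r : ℕ) : Prop :=
  ∀ v : V, (G.neighborSet v).ncard = r

/-- `G` is 2-connected: connected, at least 3 vertices, and no cut vertex. -/
def TwoConnected [Fintype V] (G : SimpleGraph V) : Prop :=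
  G.Connected ∧ 3 ≤ Fintype.card V ∧ ∀ v : V, (G.induce {u | u ≠ v}).Connected

/-- `G` is `r`-connected: more than `r` vertices and deleting fewer than `r`
vertices leaves it connected. -/
def KConnected [Fintype V] (r : ℕ) (G : SimpleGraph V) : Prop :=
  r < Fintype.card V ∧ ∀ S : Set V, S.ncard < r → (G.induce Sᶜ).Connected

/-- A set of edges is a matching: pairwise non-adjacent edges. -/
def IsMatchingSet (M : Set (Sym2 V)) : Prop :=
  M.Pairwise fun e f => ∀ v : V, v ∈ e → v ∉ f

section CubicDarts

open Finset
open scoped Classical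

/-- A cubic (multi)graph on the vertex set `S`, encoded by darts: the three darts at `v` are the
pairs `(v, i)`, and `τ` reverses darts. -/
def IsCubicMap (S : Finset V) (τ : V × Fin 3 → V × Fin 3) : Prop :=
  ∀ d, d.1 ∈ S → (τ d).1 ∈ S ∧ τ (τ d) = d ∧ τ d ≠ d

/-- The darts leaving `X`. -/
noncomputable def cut (τ : V × Fin 3 → V × Fin 3) (X : Finset V) : Finset (V × Fin 3) :=
  (X ×ˢ univ).filter fun d => (τ d).1 ∉ X

/-- Every edge cut of the cubic graph has at least three edges. -/
def EdgeConn3 (S : Finset V) (τ : V × Fin 3 → V × Fin 3) : Prop :=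
  ∀ X ⊆ S, X.Nonempty → X ≠ S → 3 ≤ (cut τ X).card

/-- The dart `d` is chosen by `m`, which selects one dart at every vertex. -/
def Matched (m : V → Fin 3) (d : V × Fin 3) : Prop := m d.1 = d.2

/-- The selection `m` is a perfect matching. -/
def IsPM (S : Finset V) (τ : V × Fin 3 → V × Fin 3) (m : V → Fin 3) : Prop :=
  ∀ d, d.1 ∈ S → Matched m d → Matched m (τ d)

/-- A nonempty 2-regular subgraph, as a set of darts. -/
def IsObj (S : Finset V) (τ : V × Fin 3 → V × Fin 3) (O : Set (V × Fin 3)) : Prop :=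
  O.Nonempty ∧ (∀ d ∈ O, d.1 ∈ S) ∧ (∀ d ∈ O, τ d ∈ O) ∧
    ∀ v, (∀ i, (v, i) ∉ O) ∨ ∃ k, ∀ i, (v, i) ∈ O ↔ i ≠ k

/-- A family of edge-disjoint 2-regular subgraphs. -/
def IsFamily (S : Finset V) (τ : V × Fin 3 → V × Fin 3) (𝒪 : Set (Set (V × Fin 3))) : Prop :=
  (∀ O ∈ 𝒪, IsObj S τ O) ∧ 𝒪.Pairwise Disjoint

/-- For every family of edge-disjoint 2-regular subgraphs and every dart at an uncovered vertex,
some perfect matching contains the dart and meets all members of the family. -/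
def Good (S : Finset V) (τ : V × Fin 3 → V × Fin 3) : Prop :=
  ∀ 𝒪, IsFamily S τ 𝒪 → ∀ e : V × Fin 3, e.1 ∈ S → (∀ O ∈ 𝒪, ∀ i, (e.1, i) ∉ O) →
    ∃ m, IsPM S τ m ∧ Matched m e ∧ ∀ O ∈ 𝒪, ∃ d ∈ O, Matched m d

lemma even_card_of_involution {α : Type*} (s : Finset α) (f : α → α) (h1 : ∀ a ∈ s, f a ∈ s)
    (h2 : ∀ a ∈ s, f (f a) = a) (h3 : ∀ a ∈ s, f a ≠ a) : Even s.card := by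
  have h : ∑ _a ∈ s, (1 : ZMod 2) = 0 :=
    Finset.sum_involution (fun a _ => f a) (fun a _ => by decide) (fun a ha _ => h3 a ha)
      (fun a ha => h1 a ha) (fun a ha => h2 a ha)
  simpa [ZMod.natCast_eq_zero_iff_even] using h

variable {S X : Finset V} {τ : V × Fin 3 → V × Fin 3}

lemma mem_cut {d : V × Fin 3} : d ∈ cut τ X ↔ d.1 ∈ X ∧ (τ d).1 ∉ X := by
  simp [cut]

lemma IsCubicMap.inj (h : IsCubicMap S τ) {d d' : V × Fin 3} (hd : d.1 ∈ S) (hd' : d'.1 ∈ S)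
    (hh : τ d = τ d') : d = d' := by
  rw [← (h d hd).2.1, hh, (h d' hd').2.1]

lemma card_cut_sdiff (h : IsCubicMap S τ) (hX : X ⊆ S) :
    (cut τ (S \ X)).card = (cut τ X).card := by
  refine Finset.card_bij (fun d _ => τ d) ?_ ?_ ?_
  · intro d hd
    have := h d
    grind [mem_cut]
  · intro d hd d' hd' hh
    exact h.inj (by grind [mem_cut]) (by grind [mem_cut]) hh
  · intro d hd
    have := h d
    refine ⟨τ d, ?_, ?_⟩ <;> grind [mem_cut]

lemma even_card_cut_add (h : IsCubicMap S τ) (hX : X ⊆ S) :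
    Even ((cut τ X).card + X.card) := by
  have h1 := Finset.card_filter_add_card_filter_not (s := X ×ˢ (univ : Finset (Fin 3)))
    (fun d => (τ d).1 ∉ X)
  have h2 : Even ((X ×ˢ (univ : Finset (Fin 3))).filter fun d => ¬ (τ d).1 ∉ X).card := by
    apply even_card_of_involution _ τ
    · intro d hd
      have := h d
      grind
    · intro d hd
      have := h d
      grind
    · intro d hd
      have := h d
      grind
  rw [Finset.card_product, Finset.card_univ, Fintype.card_fin] at h1
  change (cut τ X).card + _ = _ at h1
  grind

lemma IsObj.even_card (O : Set (V × Fin 3)) (hO : IsObj S τ O) (h : IsCubicMap S τ) (hX : X ⊆ S) :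
    Even ((cut τ X).filter (· ∈ O)).card := by
  have h1 := Finset.card_filter_add_card_filter_not
    (s := (X ×ˢ (univ : Finset (Fin 3))).filter (· ∈ O)) (fun d => (τ d).1 ∉ X)
  have h2 : Even (((X ×ˢ (univ : Finset (Fin 3))).filter (· ∈ O)).filter
      fun d => ¬ (τ d).1 ∉ X).card := by
    apply even_card_of_involution _ τ
    · intro d hd
      have := h d
      have := hO.2.2.1 d
      grind
    · intro d hd
      have := h d
      grind
    · intro d hd
      have := h d
      grind
  have h3 : Even ((X ×ˢ (univ : Finset (Fin 3))).filter (· ∈ O)).card := by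
    have key : ∀ v i, (v, i) ∈ O → ∃ j, j ≠ i ∧ (v, j) ∈ O ∧
        ∀ j', j' ≠ i → (v, j') ∈ O → j' = j := by
      intro v i hi
      rcases hO.2.2.2 v with h0 | ⟨k, hk⟩
      · exact absurd hi (h0 i)
      · have : ∀ i k : Fin 3, i ≠ k → ∃ j, j ≠ i ∧ j ≠ k ∧ ∀ j', j' ≠ i → j' ≠ k → j' = j := by
          decide
        obtain ⟨j, hj⟩ := this i k ((hk i).1 hi)
        exact ⟨j, by grind⟩
    choose! g hg using key
    apply even_card_of_involution _ (fun d => (d.1, g d.1 d.2))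
    · rintro ⟨v, i⟩ hd
      have := hg v i
      grind
    · rintro ⟨v, i⟩ hd
      have := hg v i
      have := hg v (g v i)
      grind
    · rintro ⟨v, i⟩ hd
      have := hg v i
      grind
  have h4 : ((X ×ˢ (univ : Finset (Fin 3))).filter (· ∈ O)).filter (fun d => (τ d).1 ∉ X) =
      (cut τ X).filter (· ∈ O) := by
    ext d; simp [cut]; tauto
  rw [h4] at h1
  grind

lemma cut_card_add_le (I : Finset (V × Fin 3)) (hI : ∀ d ∈ I, d.1 ∈ X ∧ (τ d).1 ∈ X) :
    (cut τ X).card + I.card ≤ 3 * X.card := by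
  rw [← Finset.card_union_of_disjoint]
  · calc _ ≤ (X ×ˢ (univ : Finset (Fin 3))).card := by
          apply Finset.card_le_card
          intro d hd
          have := hI d
          grind [mem_cut]
      _ = _ := by rw [Finset.card_product, Finset.card_univ, Fintype.card_fin, mul_comm]
  · rw [Finset.disjoint_left]
    intro d hd hd'
    have := hI d
    grind [mem_cut]

lemma no_loop (h : IsCubicMap S τ) (hc : EdgeConn3 S τ) (hS : 2 ≤ S.card) {d : V × Fin 3}
    (hd : d.1 ∈ S) : (τ d).1 ≠ d.1 := by
  intro hl
  have h1 := hc {d.1} (by simpa using hd) (by simp) (by rintro rfl; simp at hS)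
  have h2 := cut_card_add_le (X := {d.1}) (τ := τ) {d} (by grind)
  simp at h2
  omega

lemma no_parallel (h : IsCubicMap S τ) (hc : EdgeConn3 S τ) (hS : 3 ≤ S.card) {d d' : V × Fin 3}
    (hd : d.1 ∈ S) (he : d.1 = d'.1) (hh : (τ d).1 = (τ d').1) : d = d' := by
  by_contra hne
  have hl := no_loop h hc (by omega) hd
  have hl' : ({d.1, (τ d).1} : Finset V).card = 2 := Finset.card_pair hl.symm
  have h1 := hc {d.1, (τ d).1} (by have := h d; grind) (by simp)
    (by intro h0; rw [h0] at hl'; omega)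
  have h3 := h d hd
  have h4 := h d' (he ▸ hd)
  have h2 := cut_card_add_le (X := {d.1, (τ d).1}) (τ := τ) {d, d', τ d, τ d'} (by grind)
  have h5 : ({d, d', τ d, τ d'} : Finset (V × Fin 3)).card = 4 := by
    have : τ d ≠ τ d' := by grind
    have : d ≠ τ d := by grind
    have : d ≠ τ d' := by grind
    have : d' ≠ τ d := by grind
    have : d' ≠ τ d' := by grind
    simp [*]
  omega

lemma cut_card_le (hX : ∀ v ∈ X, ∃ i j, i ≠ j ∧ (τ (v, i)).1 ∈ X ∧ (τ (v, j)).1 ∈ X) :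
    (cut τ X).card ≤ X.card := by
  apply Finset.card_le_card_of_injOn Prod.fst
  · intro d hd
    exact (mem_cut.1 hd).1
  · rintro ⟨v, i⟩ hd ⟨v', i'⟩ hd' (rfl : v = v')
    have h1 := mem_cut.1 hd
    have h2 := mem_cut.1 hd'
    obtain ⟨a, b, hab, ha, hb⟩ := hX v h1.1
    have : ∀ a b i i' : Fin 3, a ≠ b → i ≠ a → i ≠ b → i' ≠ a → i' ≠ b → i = i' := by decide
    have := this a b i i' hab
    grind

/-- Two vertices joined by an edge. -/
def DAdj (τ : V × Fin 3 → V × Fin 3) (u v : V) : Prop := ∃ i, (τ (u, i)).1 = v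

lemma IsCubicMap.dadj_symm (h : IsCubicMap S τ) {u v : V} (hu : u ∈ S) (huv : DAdj τ u v) :
    DAdj τ v u := by
  obtain ⟨i, rfl⟩ := huv
  exact ⟨(τ (u, i)).2, by simp [(h (u, i) hu).2.1]⟩

lemma IsCubicMap.dadj_mem (h : IsCubicMap S τ) {u v : V} (hu : u ∈ S) (huv : DAdj τ u v) :
    v ∈ S := by
  obtain ⟨i, rfl⟩ := huv
  exact (h (u, i) hu).1

/-- Cuts with at most four edges have a side with at most two vertices. -/
def Tight (S : Finset V) (τ : V × Fin 3 → V × Fin 3) : Prop :=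
  ∀ X ⊆ S, (cut τ X).card ≤ 4 → X.card ≤ 2 ∨ (S \ X).card ≤ 2

lemma two_le_cut_of_two_nbrs (hT : Tight S τ) (hX : X ⊆ S) (h3 : 3 ≤ X.card) (h4 : X.card ≤ 4)
    (hS : X.card + 3 ≤ S.card)
    (h : ∀ v ∈ X, ∃ a b, a ≠ b ∧ a ∈ X ∧ b ∈ X ∧ DAdj τ v a ∧ DAdj τ v b) : False := by
  have h1 := cut_card_le (τ := τ) (X := X) (by
    intro v hv
    obtain ⟨a, b, hab, ha, hb, ⟨i, hi⟩, j, hj⟩ := h v hv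
    refine ⟨i, j, ?_, ?_, ?_⟩ <;> grind)
  have h2 := hT X hX (by omega)
  rw [Finset.card_sdiff_of_subset hX] at h2
  omega

lemma dadj_ne (h : IsCubicMap S τ) (hc : EdgeConn3 S τ) (hS : 2 ≤ S.card) {u v : V}
    (hu : u ∈ S) (huv : DAdj τ u v) : u ≠ v := by
  obtain ⟨i, rfl⟩ := huv
  exact (no_loop h hc hS (d := (u, i)) hu).symm

lemma no_triangle (h : IsCubicMap S τ) (hc : EdgeConn3 S τ) (hT : Tight S τ) (hS : 6 ≤ S.card)
    {a b c : V} (ha : a ∈ S) (hab : DAdj τ a b) (hbc : DAdj τ b c) (hca : DAdj τ c a) : False := by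
  have hb := h.dadj_mem ha hab
  have hcS := h.dadj_mem hb hbc
  have h1 := dadj_ne h hc (by omega) ha hab
  have h2 := dadj_ne h hc (by omega) hb hbc
  have h3 := dadj_ne h hc (by omega) hcS hca
  have hba := h.dadj_symm ha hab
  have hcb := h.dadj_symm hb hbc
  have hac := h.dadj_symm hcS hca
  have hcard : ({a, b, c} : Finset V).card = 3 :=
    Finset.card_eq_three.2 ⟨a, b, c, h1, h3.symm, h2, rfl⟩
  refine two_le_cut_of_two_nbrs hT (X := {a, b, c}) ?_ (by omega) (by omega) (by omega) ?_
  · grind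
  · intro v hv
    simp only [mem_insert, mem_singleton] at hv
    rcases hv with rfl | rfl | rfl
    · exact ⟨b, c, h2, by simp, by simp, hab, hac⟩
    · exact ⟨a, c, h3.symm, by simp, by simp, hba, hbc⟩
    · exact ⟨a, b, h1, by simp, by simp, hca, hcb⟩

lemma no_square (h : IsCubicMap S τ) (hc : EdgeConn3 S τ) (hT : Tight S τ) (hS : 7 ≤ S.card)
    {a b c d : V} (ha : a ∈ S) (hab : DAdj τ a b) (hbc : DAdj τ b c) (hcd : DAdj τ c d)
    (hda : DAdj τ d a) (hac : a ≠ c) (hbd : b ≠ d) : False := by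
  have hb := h.dadj_mem ha hab
  have hcS := h.dadj_mem hb hbc
  have hdS := h.dadj_mem hcS hcd
  have h1 := dadj_ne h hc (by omega) ha hab
  have h2 := dadj_ne h hc (by omega) hb hbc
  have h3 := dadj_ne h hc (by omega) hcS hcd
  have h4 := dadj_ne h hc (by omega) hdS hda
  have hba := h.dadj_symm ha hab
  have hcb := h.dadj_symm hb hbc
  have hdc := h.dadj_symm hcS hcd
  have had := h.dadj_symm hdS hda
  have hcard : ({a, b, c, d} : Finset V).card = 4 :=
    Finset.card_eq_four.2 ⟨a, b, c, d, h1, hac, h4.symm, h2, hbd, h3, rfl⟩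
  refine two_le_cut_of_two_nbrs hT (X := {a, b, c, d}) ?_ (by omega) (by omega) (by omega) ?_
  · grind
  · intro v hv
    simp only [mem_insert, mem_singleton] at hv
    rcases hv with rfl | rfl | rfl | rfl
    · exact ⟨b, d, hbd, by simp, by simp, hab, had⟩
    · exact ⟨a, c, hac, by simp, by simp, hba, hbc⟩
    · exact ⟨b, d, hbd, by simp, by simp, hcb, hcd⟩
    · exact ⟨a, c, hac, by simp, by simp, hda, hdc⟩

lemma IsFamily.eq_of_mem {𝒪 : Set (Set (V × Fin 3))} (hF : IsFamily S τ 𝒪) {O O' : Set (V × Fin 3)}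
    (hO : O ∈ 𝒪) (hO' : O' ∈ 𝒪) {v : V} {i j : Fin 3} (hi : (v, i) ∈ O) (hj : (v, j) ∈ O') :
    O = O' := by
  by_contra hne
  have hd := hF.2 hO hO' hne
  rw [Set.disjoint_left] at hd
  rcases (hF.1 O hO).2.2.2 v with h | ⟨k, hk⟩
  · exact h _ hi
  rcases (hF.1 O' hO').2.2.2 v with h | ⟨k', hk'⟩
  · exact h _ hj
  have : ∀ k k' : Fin 3, ∃ i, i ≠ k ∧ i ≠ k' := by decide
  obtain ⟨i, h1, h2⟩ := this k k'
  exact hd ((hk i).2 h1) ((hk' i).2 h2)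

lemma IsFamily.mono {𝒪 𝒪' : Set (Set (V × Fin 3))} (hF : IsFamily S τ 𝒪) (h : 𝒪' ⊆ 𝒪) :
    IsFamily S τ 𝒪' :=
  ⟨fun O hO => hF.1 O (h hO), hF.2.mono h⟩

/-- The selection `m` is a matching inside `A`. -/
def HalfPM (A : Finset V) (τ : V × Fin 3 → V × Fin 3) (m : V → Fin 3) : Prop :=
  ∀ d, d.1 ∈ A → (τ d).1 ∈ A → Matched m d → Matched m (τ d)

lemma isPM_glue {A : Finset V} {m₁ m₂ : V → Fin 3} (h : IsCubicMap S τ)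
    (h1 : HalfPM A τ m₁) (h2 : HalfPM (S \ A) τ m₂)
    (h12 : ∀ d ∈ cut τ A, Matched m₁ d ↔ Matched m₂ (τ d)) :
    IsPM S τ fun v => if v ∈ A then m₁ v else m₂ v := by
  intro d hd hm
  have h3 := h d hd
  have h4 := h1 d
  have h5 := h2 d
  have h6 := h12 d
  have h7 := h12 (τ d)
  by_cases hdA : d.1 ∈ A <;> by_cases hdA' : (τ d).1 ∈ A <;> simp_all [Matched, mem_cut]

/-- Attach the darts `a j` of a cut to the darts `p j` of new vertices. -/
noncomputable def plug {ι : Type*} (a p : ι → V × Fin 3) (τ : V × Fin 3 → V × Fin 3) :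
    V × Fin 3 → V × Fin 3 := fun d =>
  if h : ∃ j, p j = d then a h.choose else if h : ∃ j, a j = d then p h.choose else τ d

lemma plug_port {ι : Type*} {a p : ι → V × Fin 3} (hp : p.Injective) (j : ι) :
    plug a p τ (p j) = a j := by
  have h : ∃ j', p j' = p j := ⟨j, rfl⟩
  rw [plug, dif_pos h, hp h.choose_spec]

lemma plug_cut {ι : Type*} {a p : ι → V × Fin 3} (ha : a.Injective) (hap : ∀ i j, p i ≠ a j)
    (j : ι) : plug a p τ (a j) = p j := by
  have h : ∃ j', a j' = a j := ⟨j, rfl⟩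
  rw [plug, dif_neg (by simpa using fun i => hap i j), dif_pos h, ha h.choose_spec]

lemma plug_other {ι : Type*} {a p : ι → V × Fin 3} {d : V × Fin 3} (h1 : ∀ j, p j ≠ d)
    (h2 : ∀ j, a j ≠ d) : plug a p τ d = τ d := by
  rw [plug, dif_neg (by simpa using h1), dif_neg (by simpa using h2)]

/-- The part of an edge set in `A`, extended to new darts `p j` according to the darts `a j`. -/
def closing {ι : Type*} (a p : ι → V × Fin 3) (A : Finset V) (O : Set (V × Fin 3)) :
    Set (V × Fin 3) :=
  {d | d.1 ∈ A ∧ d ∈ O ∨ ∃ j, p j = d ∧ a j ∈ O}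

lemma IsObj.even_card_ports {ι : Type*} [Fintype ι] {O : Set (V × Fin 3)} (hO : IsObj S τ O)
    (h : IsCubicMap S τ) (hX : X ⊆ S) {a : ι → V × Fin 3} (ha : a.Injective)
    (hcut : ∀ d, d ∈ cut τ X ↔ ∃ j, a j = d) : Even (univ.filter fun j => a j ∈ O).card := by
  rw [← Finset.card_map ⟨a, ha⟩]
  convert hO.even_card O h hX
  ext d
  simp only [mem_map, mem_filter, mem_univ, true_and, Function.Embedding.coeFn_mk, hcut]
  grind

lemma half_of_three_cut {A : Finset V} {c : V} (h : IsCubicMap S τ) (hc : EdgeConn3 S τ)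
    (hA : A ⊆ S) (hcA : c ∉ A) (hcS : c ∈ S) {a : Fin 3 → V × Fin 3} (ha : a.Injective)
    (hcut : ∀ d, d ∈ cut τ A ↔ ∃ j, a j = d)
    (IH : ∀ τ', IsCubicMap (insert c A) τ' → EdgeConn3 (insert c A) τ' → Good (insert c A) τ')
    {𝒬 : Set (Set (V × Fin 3))} (hQ : IsFamily S τ 𝒬) (hQA : ∀ Q ∈ 𝒬, ∃ d ∈ Q, d.1 ∈ A)
    {e : V × Fin 3} (he : e.1 ∈ A ∧ (∀ O ∈ 𝒬, ∀ i, (e.1, i) ∉ O) ∨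
      e.1 = c ∧ ∀ O ∈ 𝒬, ∀ d ∈ O, d.1 ∈ A) :
    ∃ m, HalfPM A τ m ∧ (e.1 ∈ A → Matched m e) ∧
      (∃ j₀, (∀ j, Matched m (a j) ↔ j = j₀) ∧ (e.1 = c → e.2 = j₀)) ∧
      ∀ Q ∈ 𝒬, ∃ d ∈ Q, d.1 ∈ A ∧ Matched m d := by
  set p : Fin 3 → V × Fin 3 := fun j => (c, j) with hp
  have hpi : p.Injective := fun i j hij => by simpa [hp] using hij
  have haA : ∀ j, (a j).1 ∈ A ∧ (τ (a j)).1 ∉ A := fun j => mem_cut.1 ((hcut _).2 ⟨j, rfl⟩)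
  have hap : ∀ i j, p i ≠ a j := fun i j hij => by
    have := (haA j).1
    rw [← hij] at this
    exact hcA this
  set τ' := plug a p τ with hτ'
  have t1 : ∀ j, τ' (c, j) = a j := plug_port hpi
  have t2 : ∀ j, τ' (a j) = (c, j) := plug_cut ha hap
  have t3 : ∀ d, d.1 ∈ A → (τ d).1 ∈ A → τ' d = τ d := by
    intro d hd hd'
    refine plug_other ?_ ?_
    · rintro j rfl
      exact hcA hd
    · rintro j rfl
      exact (haA j).2 hd'
  have t4 : ∀ d, d.1 ∈ A → (τ d).1 ∈ A ∨ ∃ j, a j = d := by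
    intro d hd
    by_cases hd' : (τ d).1 ∈ A
    · exact .inl hd'
    · exact .inr ((hcut d).1 (mem_cut.2 ⟨hd, hd'⟩))
  have hcub : IsCubicMap (insert c A) τ' := by
    rintro ⟨v, i⟩ hv
    rcases Finset.mem_insert.1 hv with hv | hv
    · obtain rfl : v = c := hv
      rw [t1, t2]
      exact ⟨mem_insert_of_mem (haA i).1, rfl, (hap i i).symm⟩
    · rcases t4 (v, i) hv with h4 | ⟨j, hj⟩
      · have h5 := h (v, i) (hA hv)
        rw [t3 _ hv h4, t3 _ h4 (by rw [h5.2.1]; exact hv)]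
        exact ⟨mem_insert_of_mem h4, h5.2⟩
      · rw [← hj, t2, t1]
        exact ⟨mem_insert_self _ _, rfl, hap _ _⟩
  have hcutX : ∀ X ⊆ A, cut τ' X = cut τ X := by
    intro X hX
    ext d
    rw [mem_cut, mem_cut]
    refine and_congr_right fun hd => ?_
    rcases t4 d (hX hd) with h4 | ⟨j, hj⟩
    · rw [t3 d (hX hd) h4]
    · rw [← hj, t2]
      have := (haA j).2
      grind
  have hconn : EdgeConn3 (insert c A) τ' := by
    have key : ∀ X ⊆ A, X.Nonempty → 3 ≤ (cut τ' X).card := by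
      intro X hX hne
      rw [hcutX X hX]
      exact hc X (hX.trans hA) hne (by rintro rfl; exact hcA (hX hcS))
    intro X hX hne hXS
    by_cases hcX : c ∈ X
    · rw [← card_cut_sdiff hcub hX]
      apply key
      · grind
      · rw [Finset.sdiff_nonempty]
        exact fun h' => hXS (hX.antisymm h')
    · exact key X (by grind) hne
  have hfam : IsFamily (insert c A) τ' (closing a p A '' 𝒬) := by
    constructor
    · rintro _ ⟨O, hO, rfl⟩
      have hobj := hQ.1 O hO
      refine ⟨?_, ?_, ?_, ?_⟩
      · obtain ⟨d, hd, hdA⟩ := hQA O hO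
        exact ⟨d, .inl ⟨hdA, hd⟩⟩
      · rintro d (⟨hd, -⟩ | ⟨j, rfl, -⟩)
        · exact mem_insert_of_mem hd
        · exact mem_insert_self _ _
      · rintro d (⟨hd, hdO⟩ | ⟨j, rfl, hj⟩)
        · rcases t4 d hd with h4 | ⟨j, rfl⟩
          · rw [t3 d hd h4]
            exact .inl ⟨h4, hobj.2.2.1 d hdO⟩
          · rw [t2]
            exact .inr ⟨j, rfl, hdO⟩
        · rw [show τ' (p j) = a j from t1 j]
          exact .inl ⟨(haA j).1, hj⟩
      · intro v
        by_cases hv : v ∈ A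
        · have : ∀ i, (v, i) ∈ closing a p A O ↔ (v, i) ∈ O := by
            intro i
            simp only [closing, Set.mem_ofPred_eq, hp, Prod.mk.injEq]
            grind
          simp only [this]
          exact hobj.2.2.2 v
        · by_cases hvc : v = c
          · subst hvc
            have : ∀ i, (v, i) ∈ closing a p A O ↔ a i ∈ O := by
              intro i
              simp only [closing, Set.mem_ofPred_eq, hp, Prod.mk.injEq]
              grind
            simp only [this]
            have hev := hobj.even_card_ports h hA ha hcut
            rw [Finset.card_filter, Fin.sum_univ_three] at hev
            by_cases h0 : a 0 ∈ O <;> by_cases h1 : a 1 ∈ O <;> by_cases h2 : a 2 ∈ O <;>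
              simp only [h0, h1, h2, if_true, if_false] at hev <;>
              first
              | exact absurd hev (by decide)
              | simp [Fin.forall_fin_succ, Fin.exists_fin_succ, h0, h1, h2]
          · left
            rintro i (⟨hv', -⟩ | ⟨j, hj, -⟩)
            · exact hv hv'
            · exact hvc (congrArg Prod.fst hj).symm
    · rintro _ ⟨O, hO, rfl⟩ _ ⟨O', hO', rfl⟩ hne
      have hd := hQ.2 hO hO' (by rintro rfl; exact hne rfl)
      rw [Set.disjoint_left] at *
      rintro d (⟨hd1, hd2⟩ | ⟨j, rfl, hj⟩) (⟨hd3, hd4⟩ | ⟨j', hjj, hj'⟩)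
      · exact hd hd2 hd4
      · rw [← hjj] at hd1; exact hcA hd1
      · exact hcA hd3
      · rw [hpi hjj] at hj'; exact hd hj hj'
  obtain ⟨m, hm, hme, hmO⟩ := IH τ' hcub hconn _ hfam e
    (by rcases he with he | he
        · exact mem_insert_of_mem he.1
        · rw [he.1]; exact mem_insert_self _ _)
    (by
      rintro _ ⟨O, hO, rfl⟩ i (⟨hi1, hi2⟩ | ⟨j, hj, hj'⟩)
      · rcases he with he | he
        · exact he.2 O hO i hi2
        · rw [he.1] at hi1; exact hcA hi1
      · have : c = e.1 := congrArg Prod.fst hj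
        rcases he with he | he
        · rw [← this] at he; exact hcA he.1
        · have h1 := (hQ.1 O hO).2.2.1 _ hj'
          exact (haA j).2 (he.2 O hO _ h1))
  have hma : ∀ j, Matched m (a j) ↔ j = m c := by
    intro j
    constructor
    · intro hj
      have := hm (a j) (mem_insert_of_mem (haA j).1) hj
      rw [t2] at this
      exact this.symm
    · rintro rfl
      have := hm (c, m c) (mem_insert_self _ _) rfl
      rwa [t1] at this
  refine ⟨m, ?_, fun _ => hme, ⟨m c, hma, ?_⟩, ?_⟩
  · intro d hd hd' hdm
    rw [← t3 d hd hd']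
    exact hm d (mem_insert_of_mem hd) hdm
  · intro hec
    rw [← hec]
    exact hme.symm
  · intro Q hQQ
    obtain ⟨d, (⟨hd1, hd2⟩ | ⟨j, rfl, hj⟩), hdm⟩ := hmO _ ⟨Q, hQQ, rfl⟩
    · exact ⟨d, hd2, hd1, hdm⟩
    · refine ⟨a j, hj, (haA j).1, (hma j).2 ?_⟩
      exact hdm.symm

lemma exists_enum {α : Type*} {n : ℕ} (s : Finset α) (hs : s.card = n) :
    ∃ a : Fin n → α, a.Injective ∧ ∀ d, d ∈ s ↔ ∃ j, a j = d := by
  refine ⟨fun j => ((s.equivFinOfCardEq hs).symm j).1, ?_, ?_⟩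
  · intro i j hij
    exact (s.equivFinOfCardEq hs).symm.injective (Subtype.ext hij)
  · intro d
    constructor
    · intro hd
      exact ⟨s.equivFinOfCardEq hs ⟨d, hd⟩, by simp⟩
    · rintro ⟨j, rfl⟩
      exact ((s.equivFinOfCardEq hs).symm j).2

lemma enum_compl {ι : Type*} (h : IsCubicMap S τ) (hX : X ⊆ S) {a : ι → V × Fin 3}
    (ha : a.Injective) (hcut : ∀ d, d ∈ cut τ X ↔ ∃ j, a j = d) :
    (fun j => τ (a j)).Injective ∧ ∀ d, d ∈ cut τ (S \ X) ↔ ∃ j, τ (a j) = d := by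
  have haX : ∀ j, (a j).1 ∈ X ∧ (τ (a j)).1 ∉ X := fun j => mem_cut.1 ((hcut _).2 ⟨j, rfl⟩)
  refine ⟨fun i j hij => ha (h.inj (hX (haX i).1) (hX (haX j).1) hij), fun d => ⟨fun hd => ?_, ?_⟩⟩
  · rw [mem_cut, mem_sdiff, mem_sdiff] at hd
    have h1 := h d hd.1.1
    obtain ⟨j, hj⟩ := (hcut (τ d)).1 (mem_cut.2 (by grind))
    exact ⟨j, by rw [hj, h1.2.1]⟩
  · rintro ⟨j, rfl⟩
    have h1 := h _ (hX (haX j).1)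
    have := haX j
    rw [mem_cut, h1.2.1]
    grind

lemma good_of_three_cut (h : IsCubicMap S τ) (hc : EdgeConn3 S τ) (hX : X ⊆ S)
    (hcut : (cut τ X).card = 3) (h1 : 2 ≤ X.card) (h2 : 2 ≤ (S \ X).card)
    (IH : ∀ (S' : Finset V) τ', S'.card < S.card → IsCubicMap S' τ' → EdgeConn3 S' τ' →
      Good S' τ') : Good S τ := by
  intro 𝒪 hF e he hunc
  have key : ∀ A ⊆ S, (cut τ A).card = 3 → 2 ≤ A.card → 2 ≤ (S \ A).card → e.1 ∈ A →
      ∃ m, IsPM S τ m ∧ Matched m e ∧ ∀ O ∈ 𝒪, ∃ d ∈ O, Matched m d := by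
    intro A hA hcut h1 h2 heA
    obtain ⟨a, ha, hca⟩ := exists_enum _ hcut
    obtain ⟨hb, hcb⟩ := enum_compl h hA ha hca
    obtain ⟨c, hcc⟩ : (S \ A).Nonempty := Finset.card_pos.1 (by omega)
    rw [mem_sdiff] at hcc
    have hcard := Finset.card_sdiff_add_card_eq_card hA
    obtain ⟨m₁, hm1, hm1e, ⟨j₀, hj, -⟩, hm1O⟩ := half_of_three_cut h hc hA hcc.2 hcc.1 ha hca
      (IH _ · (by rw [card_insert_of_notMem hcc.2]; omega))
      (hF.mono (𝒪' := {O ∈ 𝒪 | ∃ d ∈ O, d.1 ∈ A}) (fun O hO => hO.1)) (fun O hO => hO.2)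
      (.inl ⟨heA, fun O hO => hunc O hO.1⟩)
    have hnA : e.1 ∉ S \ A := by simp [heA]
    obtain ⟨m₂, hm2, -, ⟨j₁, hj2, hj1⟩, hm2O⟩ := half_of_three_cut h hc sdiff_subset hnA he hb hcb
      (IH _ · (by rw [card_insert_of_notMem hnA]; omega))
      (hF.mono (𝒪' := {O ∈ 𝒪 | ∀ d ∈ O, d.1 ∈ S \ A}) (fun O hO => hO.1))
      (fun O hO => by
        obtain ⟨d, hd⟩ := (hF.1 O hO.1).1
        exact ⟨d, hd, hO.2 d hd⟩)
      (e := (e.1, j₀)) (.inr ⟨rfl, fun O hO => hO.2⟩)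
    obtain rfl := hj1 rfl
    refine ⟨_, isPM_glue h hm1 hm2 ?_, ?_, ?_⟩
    · intro d hd
      obtain ⟨j, rfl⟩ := (hca d).1 hd
      rw [hj, hj2]
    · simpa [Matched, heA] using hm1e heA
    · intro O hO
      by_cases hOA : ∃ d ∈ O, d.1 ∈ A
      · obtain ⟨d, hd, hdA, hdm⟩ := hm1O O ⟨hO, hOA⟩
        exact ⟨d, hd, by simpa [Matched, hdA] using hdm⟩
      · push Not at hOA
        obtain ⟨d, hd, hdA, hdm⟩ := hm2O O
          ⟨hO, fun d hd => mem_sdiff.2 ⟨(hF.1 O hO).2.1 d hd, hOA d hd⟩⟩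
        exact ⟨d, hd, by simpa [Matched, hOA d hd] using hdm⟩
  by_cases heX : e.1 ∈ X
  · exact key X hX hcut h1 h2 heX
  · refine key (S \ X) sdiff_subset (by rw [card_cut_sdiff h hX, hcut]) h2 ?_ (by simp [he, heX])
    rwa [Finset.sdiff_sdiff_eq_self hX]

lemma two_regular_of_xor (f : Fin 3 → Prop) (hf : f 2 ↔ ¬ (f 0 ↔ f 1)) :
    (∀ i, ¬ f i) ∨ ∃ k, ∀ i, f i ↔ i ≠ k := by
  by_cases h0 : f 0 <;> by_cases h1 : f 1 <;> simp only [h0, h1] at hf <;>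
    simp [Fin.forall_fin_succ, Fin.exists_fin_succ, h0, h1] <;> simp at hf <;> simp [hf]

set_option maxHeartbeats 1600000 in
lemma half_of_four_cut {A : Finset V} {s t : V} (h : IsCubicMap S τ) (hc : EdgeConn3 S τ)
    (hA : A ⊆ S) (hs : s ∈ S ∧ s ∉ A) (ht : t ∈ S ∧ t ∉ A) (hst : s ≠ t) {a : Fin 4 → V × Fin 3}
    (ha : a.Injective) (hcut : ∀ d, d ∈ cut τ A ↔ ∃ j, a j = d) (hA3 : 3 ≤ A.card)
    (hB3 : 3 ≤ (S \ A).card)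
    (hnc : ∀ X ⊆ S, (cut τ X).card = 3 → X.card ≤ 1 ∨ (S \ X).card ≤ 1)
    (IH : ∀ τ', IsCubicMap (insert s (insert t A)) τ' → EdgeConn3 (insert s (insert t A)) τ' →
      Good (insert s (insert t A)) τ')
    {𝒬 : Set (Set (V × Fin 3))} (hQ : IsFamily S τ 𝒬) (hQA : ∀ Q ∈ 𝒬, ∃ d ∈ Q, d.1 ∈ A)
    (hone : ∀ O ∈ 𝒬, ∀ O' ∈ 𝒬, ∀ i j, a i ∈ O → a j ∈ O' → O = O')
    {e : V × Fin 3} (he : e.1 ∈ A ∧ (∀ O ∈ 𝒬, ∀ i, (e.1, i) ∉ O) ∨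
      e.1 = s ∧ ∀ O ∈ 𝒬, a 0 ∉ O ∧ a 1 ∉ O) :
    ∃ m, HalfPM A τ m ∧ (e.1 ∈ A → Matched m e) ∧
      (((∀ j, ¬ Matched m (a j)) ∧ (e.1 = s → e.2 = 2) ∧
          ∀ Q ∈ 𝒬, (∃ d ∈ Q, d.1 ∈ A ∧ Matched m d) ∨ ¬ (a 0 ∈ Q ↔ a 1 ∈ Q)) ∨
        ((∃ i k, (i = 0 ∨ i = 1) ∧ (k = 2 ∨ k = 3) ∧ (∀ j, Matched m (a j) ↔ j = i ∨ j = k) ∧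
            (e = (s, 0) → i = 0)) ∧ (e.1 = s → e.2 ≠ 2) ∧
          ∀ Q ∈ 𝒬, ∃ d ∈ Q, d.1 ∈ A ∧ Matched m d)) := by
  set S' := insert s (insert t A) with hS'
  set p : Fin 4 → V × Fin 3 := ![(s, 0), (s, 1), (t, 0), (t, 1)] with hp
  have hpi : p.Injective := by
    intro i j hij
    fin_cases i <;> fin_cases j <;> simp_all [hst.symm]
  have hpA : ∀ j, (p j).1 ∉ A := by
    intro j
    fin_cases j <;> simp [hp, hs, ht]
  have hp2 : ∀ j, p j ≠ (s, 2) ∧ p j ≠ (t, 2) := by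
    intro j
    fin_cases j <;> simp [hp]
  have hpS : ∀ j, (p j).1 ∈ S' := by
    intro j
    fin_cases j <;> simp [hp, hS']
  have haA : ∀ j, (a j).1 ∈ A ∧ (τ (a j)).1 ∉ A := fun j => mem_cut.1 ((hcut _).2 ⟨j, rfl⟩)
  have hap : ∀ i j, p i ≠ a j := fun i j hij => hpA i (by rw [hij]; exact (haA j).1)
  set τ₀ : V × Fin 3 → V × Fin 3 := fun d =>
    if d = (s, 2) then (t, 2) else if d = (t, 2) then (s, 2) else τ d with hτ₀
  set τ' := plug a p τ₀ with hτ'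
  have t1 : ∀ j, τ' (p j) = a j := plug_port hpi
  have t2 : ∀ j, τ' (a j) = p j := plug_cut ha hap
  have t3 : ∀ d, d.1 ∈ A → (τ d).1 ∈ A → τ' d = τ d := by
    intro d hd hd'
    have : τ₀ d = τ d := by grind
    rw [← this]
    refine plug_other ?_ ?_
    · rintro j rfl
      exact hpA j hd
    · rintro j rfl
      exact (haA j).2 hd'
  have t4 : ∀ d, d.1 ∈ A → (τ d).1 ∈ A ∨ ∃ j, a j = d := by
    intro d hd
    by_cases hd' : (τ d).1 ∈ A
    · exact .inl hd'
    · exact .inr ((hcut d).1 (mem_cut.2 ⟨hd, hd'⟩))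
  have t5 : τ' (s, 2) = (t, 2) := by
    rw [hτ', plug_other (fun j => (hp2 j).1) (fun j hj => hs.2 (by have := (haA j).1; grind))]
    simp [hτ₀]
  have t6 : τ' (t, 2) = (s, 2) := by
    rw [hτ', plug_other (fun j => (hp2 j).2) (fun j hj => ht.2 (by have := (haA j).1; grind))]
    simp [hτ₀, hst.symm]
  clear_value τ' τ₀
  have cases_dart : ∀ d : V × Fin 3, d.1 ∈ S' →
      d.1 ∈ A ∨ (∃ j, p j = d) ∨ d = (s, 2) ∨ d = (t, 2) := by
    rintro ⟨v, i⟩ hv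
    simp only [hS', mem_insert] at hv
    rcases hv with rfl | rfl | hv
    · fin_cases i
      · exact .inr (.inl ⟨0, rfl⟩)
      · exact .inr (.inl ⟨1, rfl⟩)
      · exact .inr (.inr (.inl rfl))
    · fin_cases i
      · exact .inr (.inl ⟨2, rfl⟩)
      · exact .inr (.inl ⟨3, rfl⟩)
      · exact .inr (.inr (.inr rfl))
    · exact .inl hv
  have hAS' : A ⊆ S' := fun v hv => by simp [hS', hv]
  have hcub : IsCubicMap S' τ' := by
    intro d hd
    rcases cases_dart d hd with hd | ⟨j, rfl⟩ | rfl | rfl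
    · rcases t4 d hd with h4 | ⟨j, rfl⟩
      · have h5 := h d (hA hd)
        rw [t3 _ hd h4, t3 _ h4 (by rw [h5.2.1]; exact hd)]
        exact ⟨hAS' h4, h5.2⟩
      · rw [t2, t1]
        exact ⟨hpS j, rfl, hap _ _⟩
    · rw [t1, t2]
      exact ⟨hAS' (haA j).1, rfl, (hap _ _).symm⟩
    · rw [t5, t6]
      simp [hS', hst.symm]
    · rw [t6, t5]
      simp [hS', hst]
  have hcutX : ∀ X ⊆ A, cut τ' X = cut τ X := by
    intro X hX
    ext d
    rw [mem_cut, mem_cut]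
    refine and_congr_right fun hd => ?_
    rcases t4 d (hX hd) with h4 | ⟨j, rfl⟩
    · rw [t3 d (hX hd) h4]
    · rw [t2]
      have := (haA j).2
      have := hpA j
      grind
  have small : ∀ X ⊆ A, (cut τ X).card ≤ 3 → X.card ≤ 1 := by
    intro X hX hle
    rcases X.eq_empty_or_nonempty with rfl | hne
    · simp
    · have h1 := hc X (hX.trans hA) hne (by rintro rfl; exact hs.2 (hX hs.1))
      have h2 := hnc X (hX.trans hA) (by omega)
      have h3 : (S \ A).card ≤ (S \ X).card := card_le_card (sdiff_subset_sdiff subset_rfl hX)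
      omega
  have split : ∀ X' ⊆ S', (cut τ' X').card ≤ 2 → ∀ u, (u = s ∧ t ∉ X' ∨ u = t ∧ s ∉ X') →
      u ∈ X' → (X' ∩ A).card ≤ 1 := by
    intro X' hX' hle u hu huX
    refine small _ inter_subset_right ?_
    obtain ⟨i, j, hij⟩ : ∃ i j, ∀ k, k ≠ i → k ≠ j → (p k).1 ∉ X' := by
      rcases hu with ⟨rfl, hu⟩ | ⟨rfl, hu⟩
      · refine ⟨0, 1, fun k => ?_⟩
        fin_cases k <;> simp [hp, hu]
      · refine ⟨2, 3, fun k => ?_⟩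
        fin_cases k <;> simp [hp, hu]
    have hu2 : (u, 2) ∈ cut τ' X' := by
      rw [mem_cut]
      rcases hu with ⟨rfl, hu⟩ | ⟨rfl, hu⟩
      · rw [t5]; exact ⟨huX, hu⟩
      · rw [t6]; exact ⟨huX, hu⟩
    have huA : u ∉ A := by
      rcases hu with ⟨rfl, hu⟩ | ⟨rfl, hu⟩
      · exact hs.2
      · exact ht.2
    have hsub : cut τ (X' ∩ A) ⊆ ((cut τ' X').erase (u, 2)) ∪ {a i, a j} := by
      intro d hd
      rw [mem_cut] at hd
      have hdA : d.1 ∈ A := (mem_inter.1 hd.1).2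
      have hne : d ≠ (u, 2) := by rintro rfl; exact huA hdA
      rw [mem_union, mem_erase, mem_cut]
      rcases t4 d hdA with h4 | ⟨k, rfl⟩
      · rw [t3 d hdA h4]
        refine .inl ⟨hne, ?_⟩
        grind
      · rw [t2]
        have := hij k
        grind
    have h1 := card_le_card hsub
    have h2 := card_union_le ((cut τ' X').erase (u, 2)) {a i, a j}
    rw [card_erase_of_mem hu2] at h2
    have h3 := Finset.card_le_two (a := a i) (b := a j)
    have h4 : 0 < (cut τ' X').card := Finset.card_pos.2 ⟨_, hu2⟩
    omega
  have hconn : EdgeConn3 S' τ' := by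
    have key : ∀ X ⊆ A, X.Nonempty → 3 ≤ (cut τ' X).card := by
      intro X hX hne
      rw [hcutX X hX]
      exact hc X (hX.trans hA) hne (by rintro rfl; exact hs.2 (hX hs.1))
    have sub : ∀ X ⊆ S', s ∉ X → t ∉ X → X ⊆ A := by
      intro X hX h1 h2 v hv
      have := hX hv
      simp only [hS', mem_insert] at this
      grind
    intro X hX hne hXS
    have hne' : (S' \ X).Nonempty := by
      rw [Finset.sdiff_nonempty]
      exact fun h' => hXS (hX.antisymm h')
    have mix : ∀ u v, (u = s ∧ v = t ∨ u = t ∧ v = s) → u ∈ X → v ∉ X → 3 ≤ (cut τ' X).card := by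
      intro u v huv huX hvX
      by_contra hlt
      have h1 := split X hX (by omega) u (by grind) huX
      have h2 := split (S' \ X) sdiff_subset (by rw [card_cut_sdiff hcub hX]; omega) v
        (by simp only [mem_sdiff]; grind) (by simp only [mem_sdiff, hS', mem_insert]; grind)
      have h3 : A ⊆ (X ∩ A) ∪ ((S' \ X) ∩ A) := by
        intro v hv
        have := hAS' hv
        grind
      have h4 := card_le_card h3
      have h5 := card_union_le (X ∩ A) ((S' \ X) ∩ A)
      omega
    by_cases hsX : s ∈ X <;> by_cases htX : t ∈ X
    · rw [← card_cut_sdiff hcub hX]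
      exact key _ (sub _ sdiff_subset (by simp [hsX]) (by simp [htX])) hne'
    · exact mix s t (.inl ⟨rfl, rfl⟩) hsX htX
    · exact mix t s (.inr ⟨rfl, rfl⟩) htX hsX
    · exact key _ (sub _ hX hsX htX) hne
  set cl : Set (V × Fin 3) → Set (V × Fin 3) := fun O =>
    {d | d.1 ∈ A ∧ d ∈ O ∨ (∃ j, p j = d ∧ a j ∈ O) ∨
      (d = (s, 2) ∨ d = (t, 2)) ∧ ¬ (a 0 ∈ O ↔ a 1 ∈ O)} with hcl
  have clA : ∀ O d, d.1 ∈ A → (d ∈ cl O ↔ d ∈ O) := by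
    intro O d hd
    have h1 : ∀ j, p j ≠ d := by rintro j rfl; exact hpA j hd
    have h2 : d ≠ (s, 2) := by rintro rfl; exact hs.2 hd
    have h3 : d ≠ (t, 2) := by rintro rfl; exact ht.2 hd
    simp [hcl, hd, h1, h2, h3]
  have clp : ∀ O j, p j ∈ cl O ↔ a j ∈ O := by
    intro O j
    simp [hcl, hpA j, (hp2 j).1, (hp2 j).2, hpi.eq_iff]
  have cls : ∀ O, (s, 2) ∈ cl O ↔ ¬ (a 0 ∈ O ↔ a 1 ∈ O) := by
    intro O
    simp only [hcl, Set.mem_ofPred_eq, hs.2, false_and, (hp2 _).1, exists_false, false_or, true_or,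
      true_and]
  have clt : ∀ O, (t, 2) ∈ cl O ↔ ¬ (a 0 ∈ O ↔ a 1 ∈ O) := by
    intro O
    simp only [hcl, Set.mem_ofPred_eq, ht.2, false_and, (hp2 _).2, exists_false, false_or, or_true,
      true_and]
  have clS : ∀ O, ∀ d ∈ cl O, d.1 ∈ S' := by
    rintro O d (⟨hd, -⟩ | ⟨j, rfl, -⟩ | ⟨rfl | rfl, -⟩)
    · exact hAS' hd
    · exact hpS j
    · simp [hS']
    · simp [hS']
  clear_value cl
  have hfam : IsFamily S' τ' (cl '' 𝒬) := by
    constructor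
    · rintro _ ⟨O, hO, rfl⟩
      have hobj := hQ.1 O hO
      refine ⟨?_, clS O, ?_, ?_⟩
      · obtain ⟨d, hd, hdA⟩ := hQA O hO
        exact ⟨d, (clA O d hdA).2 hd⟩
      · intro d hd
        rcases cases_dart d (clS O d hd) with hdA | ⟨j, rfl⟩ | rfl | rfl
        · rw [clA O d hdA] at hd
          rcases t4 d hdA with h4 | ⟨j, rfl⟩
          · rw [t3 d hdA h4, clA O _ h4]
            exact hobj.2.2.1 d hd
          · rwa [t2, clp]
        · rw [t1, clA O _ (haA j).1]
          exact (clp O j).1 hd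
        · rw [t5, clt]
          exact (cls O).1 hd
        · rw [t6, cls]
          exact (clt O).1 hd
      · intro v
        by_cases hvS : v ∈ S'
        swap
        · exact .inl fun i hi => hvS (clS O _ hi)
        simp only [hS', mem_insert] at hvS
        rcases hvS with rfl | rfl | hvA
        · refine two_regular_of_xor (fun i => (v, i) ∈ cl O) ?_
          have h0 := clp O 0
          have h1 := clp O 1
          simp only [hp, Matrix.cons_val] at h0 h1
          rw [cls, h0, h1]
        · refine two_regular_of_xor (fun i => (v, i) ∈ cl O) ?_
          have h0 := clp O 2
          have h1 := clp O 3
          simp only [hp, Matrix.cons_val] at h0 h1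
          rw [clt, h0, h1]
          have hev := hobj.even_card_ports h hA ha hcut
          rw [Finset.card_filter, Fin.sum_univ_four] at hev
          by_cases h0 : a 0 ∈ O <;> by_cases h1 : a 1 ∈ O <;> by_cases h2 : a 2 ∈ O <;>
            by_cases h3 : a 3 ∈ O <;> simp only [h0, h1, h2, h3, if_true, if_false] at hev <;>
            first
            | exact absurd hev (by decide)
            | simp [h0, h1, h2, h3]
        · simp only [fun i => clA O (v, i) hvA]
          exact hobj.2.2.2 v
    · rintro _ ⟨O, hO, rfl⟩ _ ⟨O', hO', rfl⟩ hne
      have hOO : O ≠ O' := by rintro rfl; exact hne rfl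
      have hd := hQ.2 hO hO' hOO
      rw [Set.disjoint_left] at *
      intro d hd1 hd2
      have hone' := hone O hO O' hO'
      have hex : ∀ Q : Set (V × Fin 3), ¬ (a 0 ∈ Q ↔ a 1 ∈ Q) → ∃ i, a i ∈ Q := by
        intro Q hxor
        by_contra hno
        push Not at hno
        exact hxor (by simp [hno])
      rcases cases_dart d (clS O d hd1) with hdA | ⟨j, rfl⟩ | rfl | rfl
      · exact hd ((clA O d hdA).1 hd1) ((clA O' d hdA).1 hd2)
      · exact hd ((clp O j).1 hd1) ((clp O' j).1 hd2)
      · rw [cls] at hd1 hd2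
        obtain ⟨i, hi⟩ := hex O hd1
        obtain ⟨j, hj⟩ := hex O' hd2
        exact hOO (hone' i j hi hj)
      · rw [clt] at hd1 hd2
        obtain ⟨i, hi⟩ := hex O hd1
        obtain ⟨j, hj⟩ := hex O' hd2
        exact hOO (hone' i j hi hj)
  have heS : e.1 ∈ S' := by
    rcases he with he | he
    · exact hAS' he.1
    · rw [he.1]; simp [hS']
  obtain ⟨m, hm, hme, hmO⟩ := IH τ' hcub hconn _ hfam e heS
    (by
      rintro _ ⟨O, hO, rfl⟩ i hi
      rcases he with he | he
      · exact he.2 O hO i ((clA O (e.1, i) he.1).1 hi)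
      · rw [he.1] at hi
        have h0 := clp O 0
        have h1 := clp O 1
        have h2 := cls O
        have h3 := he.2 O hO
        simp only [hp, Matrix.cons_val] at h0 h1
        have hi3 : i = 0 ∨ i = 1 ∨ i = 2 := by
          clear hi
          revert i
          decide
        rcases hi3 with rfl | rfl | rfl
        · exact h3.1 (h0.1 hi)
        · exact h3.2 (h1.1 hi)
        · exact h2.1 hi (by simp [h3]))
  have hma : ∀ j, Matched m (a j) ↔ Matched m (p j) := by
    intro j
    constructor
    · intro hj
      simpa [t2] using hm (a j) (hAS' (haA j).1) hj
    · intro hj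
      simpa [t1] using hm (p j) (hpS j) hj
  have hmst : m s = 2 ↔ m t = 2 := by
    constructor
    · intro hj
      simpa [t5, Matched] using hm (s, 2) (by simp [hS']) hj
    · intro hj
      simpa [t6, Matched] using hm (t, 2) (by simp [hS']) hj
  have hhalf : HalfPM A τ m := by
    intro d hd hd' hdm
    rw [← t3 d hd hd']
    exact hm d (hAS' hd) hdm
  have hhit : ∀ Q ∈ 𝒬, (∃ d ∈ Q, d.1 ∈ A ∧ Matched m d) ∨ m s = 2 ∧ ¬ (a 0 ∈ Q ↔ a 1 ∈ Q) := by
    intro Q hQQ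
    obtain ⟨d, hd, hdm⟩ := hmO _ ⟨Q, hQQ, rfl⟩
    rcases cases_dart d (clS Q d hd) with hdA | ⟨j, rfl⟩ | rfl | rfl
    · exact .inl ⟨d, (clA Q d hdA).1 hd, hdA, hdm⟩
    · exact .inl ⟨a j, (clp Q j).1 hd, (haA j).1, (hma j).2 hdm⟩
    · exact .inr ⟨hdm, (cls Q).1 hd⟩
    · exact .inr ⟨hmst.2 hdm, (clt Q).1 hd⟩
  refine ⟨m, hhalf, fun _ => hme, ?_⟩
  by_cases hms : m s = 2
  · refine .inl ⟨?_, ?_, fun Q hQQ => (hhit Q hQQ).imp_right And.right⟩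
    · intro j hj
      rw [hma] at hj
      have := hmst.1 hms
      fin_cases j <;> simp [hp, Matched, hms, this] at hj
    · intro hes
      rw [← hme, hes, hms]
  · refine .inr ⟨?_, ?_, fun Q hQQ => (hhit Q hQQ).resolve_right fun h' => hms h'.1⟩
    · have hmt : m t ≠ 2 := fun h' => hms (hmst.2 h')
      have f3 : ∀ x : Fin 3, x ≠ 2 → x = 0 ∨ x = 1 := by decide
      have he0 : e = (s, 0) → m s = 0 := by rintro rfl; exact hme
      rcases f3 _ hms with h1 | h1 <;> rcases f3 _ hmt with h2 | h2
      · refine ⟨0, 2, by simp, by simp, fun j => ?_, by simp⟩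
        rw [hma]
        fin_cases j <;> simp [hp, Matched, h1, h2]
      · refine ⟨0, 3, by simp, by simp, fun j => ?_, by simp⟩
        rw [hma]
        fin_cases j <;> simp [hp, Matched, h1, h2]
      · refine ⟨1, 2, by simp, by simp, fun j => ?_, fun h0 => ?_⟩
        · rw [hma]
          fin_cases j <;> simp [hp, Matched, h1, h2]
        · simp [he0 h0] at h1
      · refine ⟨1, 3, by simp, by simp, fun j => ?_, fun h0 => ?_⟩
        · rw [hma]
          fin_cases j <;> simp [hp, Matched, h1, h2]
        · simp [he0 h0] at h1
    · intro hes he2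
      apply hms
      rw [← hes, ← he2]
      exact hme

lemma IsFamily.sUnion {𝒪 : Set (Set (V × Fin 3))} (hF : IsFamily S τ 𝒪) (hne : 𝒪.Nonempty) :
    IsObj S τ (⋃₀ 𝒪) := by
  refine ⟨?_, ?_, ?_, ?_⟩
  · obtain ⟨O, hO⟩ := hne
    obtain ⟨d, hd⟩ := (hF.1 O hO).1
    exact ⟨d, O, hO, hd⟩
  · rintro d ⟨O, hO, hd⟩
    exact (hF.1 O hO).2.1 d hd
  · rintro d ⟨O, hO, hd⟩
    exact ⟨O, hO, (hF.1 O hO).2.2.1 d hd⟩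
  · intro v
    by_cases hv : ∃ O ∈ 𝒪, ∃ i, (v, i) ∈ O
    · obtain ⟨O, hO, i, hi⟩ := hv
      have : ∀ j, (v, j) ∈ ⋃₀ 𝒪 ↔ (v, j) ∈ O := by
        intro j
        constructor
        · rintro ⟨O', hO', hj⟩
          rwa [hF.eq_of_mem hO hO' hi hj]
        · exact fun hj => ⟨O, hO, hj⟩
      simp only [this]
      exact (hF.1 O hO).2.2.2 v
    · left
      rintro i ⟨O, hO, hi⟩
      exact hv ⟨O, hO, i, hi⟩

lemma exists_common_pair {P Q : Fin 4 → Fin 4 → Prop}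
    (hP : ∀ σ : Equiv.Perm (Fin 4), ∃ i k, (i = 0 ∨ i = 1) ∧ (k = 2 ∨ k = 3) ∧ P (σ i) (σ k))
    (hQ : ∀ i k l, i ≠ k → i ≠ l → k ≠ l → Q i k ∨ Q i l) (hQs : ∀ i k, Q i k → Q k i) :
    ∃ i k, P i k ∧ Q i k := by
  by_contra! hno
  have perm : ∀ i k : Fin 4, i ≠ k → ∃ σ : Equiv.Perm (Fin 4), σ 0 = i ∧ σ 1 = k := by decide
  obtain ⟨i, k, hi, hk, hik⟩ := hP 1
  have hne : i ≠ k := by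
    rintro rfl
    rcases hi with rfl | rfl <;> revert hk <;> decide
  simp only [Equiv.Perm.one_apply] at hik
  have h1 := hno _ _ hik
  obtain ⟨σ, rfl, rfl⟩ := perm i k hne
  obtain ⟨i', k', hi', hk', hik'⟩ := hP σ
  have h2 := hno _ _ hik'
  have h0k : 0 ≠ k' := by rintro rfl; revert hk'; decide
  have h1k : 1 ≠ k' := by rintro rfl; revert hk'; decide
  rcases hi' with rfl | rfl
  · have := hQ (σ 0) (σ 1) (σ k') hne (by simpa using h0k) (by simpa using h1k)
    tauto
  · have := hQ (σ 1) (σ 0) (σ k') hne.symm (by simpa using h1k) (by simpa using h0k)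
    have := hQs (σ 1) (σ 0)
    tauto

section FourCut

variable {A : Finset V} {a : Fin 4 → V × Fin 3} {𝒪 : Set (Set (V × Fin 3))}

lemma two_le_card_ports (h : IsCubicMap S τ) (hA : A ⊆ S) (ha : a.Injective)
    (hcut : ∀ d, d ∈ cut τ A ↔ ∃ j, a j = d) (hF : IsFamily S τ 𝒪) {O : Set (V × Fin 3)}
    (hO : O ∈ 𝒪) {j : Fin 4} (hj : a j ∈ O) : 2 ≤ (univ.filter fun j => a j ∈ O).card := by
  have h1 := (hF.1 O hO).even_card_ports h hA ha hcut
  have h2 : 0 < (univ.filter fun j => a j ∈ O).card := Finset.card_pos.2 ⟨j, by simpa using hj⟩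
  obtain ⟨r, hr⟩ := h1
  omega

lemma disjoint_ports (hF : IsFamily S τ 𝒪) {O O' : Set (V × Fin 3)} (hO : O ∈ 𝒪) (hO' : O' ∈ 𝒪)
    (hne : O ≠ O') :
    Disjoint (univ.filter fun j => a j ∈ O) (univ.filter fun j => a j ∈ O') := by
  rw [Finset.disjoint_left]
  intro j hj hj'
  simp only [mem_filter, mem_univ, true_and] at hj hj'
  exact Set.disjoint_left.1 (hF.2 hO hO' hne) hj hj'

/-- Among disjoint 2-regular subgraphs, at most two cross a cut with four edges. -/
lemma eq_of_crossing (h : IsCubicMap S τ) (hA : A ⊆ S) (ha : a.Injective)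
    (hcut : ∀ d, d ∈ cut τ A ↔ ∃ j, a j = d) (hF : IsFamily S τ 𝒪) {O₁ O₂ O₃ : Set (V × Fin 3)}
    (h1 : O₁ ∈ 𝒪) (h2 : O₂ ∈ 𝒪) (h3 : O₃ ∈ 𝒪) {j₁ j₂ j₃ : Fin 4} (hj1 : a j₁ ∈ O₁)
    (hj2 : a j₂ ∈ O₂) (hj3 : a j₃ ∈ O₃) (h12 : O₁ ≠ O₂) (h13 : O₁ ≠ O₃) : O₂ = O₃ := by
  by_contra h23
  have c1 := two_le_card_ports h hA ha hcut hF h1 hj1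
  have c2 := two_le_card_ports h hA ha hcut hF h2 hj2
  have c3 := two_le_card_ports h hA ha hcut hF h3 hj3
  have d1 := disjoint_ports (a := a) hF h1 h2 h12
  have d2 := disjoint_ports (a := a) hF h1 h3 h13
  have d3 := disjoint_ports (a := a) hF h2 h3 h23
  have e1 := card_le_univ ((univ.filter fun j => a j ∈ O₁) ∪ ((univ.filter fun j => a j ∈ O₂) ∪
    (univ.filter fun j => a j ∈ O₃)))
  rw [card_union_of_disjoint (disjoint_union_right.2 ⟨d1, d2⟩), card_union_of_disjoint d3,
    Fintype.card_fin] at e1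
  omega

lemma exists_two_notMem {n : ℕ} (P : Finset (Fin 4)) (hP : P.card = n) (hn : n ≤ 2) :
    ∃ i j, i ≠ j ∧ i ∉ P ∧ j ∉ P := by
  have h1 := card_compl P
  rw [Fintype.card_fin] at h1
  obtain ⟨i, hi, j, hj, hij⟩ := (Finset.one_lt_card (s := Pᶜ)).1 (by omega)
  exact ⟨i, j, hij, by simpa using hi, by simpa using hj⟩

end FourCut

/-- The darts `a j` enumerate a cut with four edges, and `s`, `t` are two vertices outside `A`. -/
structure FourCut (S : Finset V) (τ : V × Fin 3 → V × Fin 3) (A : Finset V)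
    (a : Fin 4 → V × Fin 3) (s t : V) : Prop where
  cubic : IsCubicMap S τ
  conn : EdgeConn3 S τ
  subset : A ⊆ S
  hs : s ∈ S ∧ s ∉ A
  ht : t ∈ S ∧ t ∉ A
  hst : s ≠ t
  inj : a.Injective
  enum : ∀ d, d ∈ cut τ A ↔ ∃ j, a j = d
  card_left : 3 ≤ A.card
  card_right : 3 ≤ (S \ A).card
  no_three_cut : ∀ X ⊆ S, (cut τ X).card = 3 → X.card ≤ 1 ∨ (S \ X).card ≤ 1
  ih : ∀ (S' : Finset V) τ', S'.card < S.card → IsCubicMap S' τ' → EdgeConn3 S' τ' → Good S' τ'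

namespace FourCut

variable {A : Finset V} {a : Fin 4 → V × Fin 3} {s t : V}

lemma perm (F : FourCut S τ A a s t) (σ : Equiv.Perm (Fin 4)) :
    FourCut S τ A (fun j => a (σ j)) s t :=
  { F with
    inj := F.inj.comp σ.injective
    enum := fun d => by
      rw [F.enum]
      exact ⟨fun ⟨j, hj⟩ => ⟨σ.symm j, by simpa using hj⟩, fun ⟨j, hj⟩ => ⟨σ j, hj⟩⟩ }

lemma compl (F : FourCut S τ A a s t) {s' t' : V} (hs' : s' ∈ A) (ht' : t' ∈ A) (hst' : s' ≠ t') :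
    FourCut S τ (S \ A) (fun j => τ (a j)) s' t' :=
  { F with
    subset := sdiff_subset
    hs := ⟨F.subset hs', by simp [hs']⟩
    ht := ⟨F.subset ht', by simp [ht']⟩
    hst := hst'
    inj := (enum_compl F.cubic F.subset F.inj F.enum).1
    enum := (enum_compl F.cubic F.subset F.inj F.enum).2
    card_left := F.card_right
    card_right := by rw [Finset.sdiff_sdiff_eq_self F.subset]; exact F.card_left }

lemma mem_left (F : FourCut S τ A a s t) (j : Fin 4) : (a j).1 ∈ A :=
  (mem_cut.1 ((F.enum _).2 ⟨j, rfl⟩)).1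

lemma notMem_right (F : FourCut S τ A a s t) (j : Fin 4) : (τ (a j)).1 ∉ A :=
  (mem_cut.1 ((F.enum _).2 ⟨j, rfl⟩)).2

lemma half (F : FourCut S τ A a s t)
    {𝒬 : Set (Set (V × Fin 3))} (hQ : IsFamily S τ 𝒬) (hQA : ∀ Q ∈ 𝒬, ∃ d ∈ Q, d.1 ∈ A)
    (hone : ∀ O ∈ 𝒬, ∀ O' ∈ 𝒬, ∀ i j, a i ∈ O → a j ∈ O' → O = O')
    {e : V × Fin 3} (he : e.1 ∈ A ∧ (∀ O ∈ 𝒬, ∀ i, (e.1, i) ∉ O) ∨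
      e.1 = s ∧ ∀ O ∈ 𝒬, a 0 ∉ O ∧ a 1 ∉ O) :
    ∃ m, HalfPM A τ m ∧ (e.1 ∈ A → Matched m e) ∧
      (((∀ j, ¬ Matched m (a j)) ∧ (e.1 = s → e.2 = 2) ∧
          ∀ Q ∈ 𝒬, (∃ d ∈ Q, d.1 ∈ A ∧ Matched m d) ∨ ¬ (a 0 ∈ Q ↔ a 1 ∈ Q)) ∨
        ((∃ i k, (i = 0 ∨ i = 1) ∧ (k = 2 ∨ k = 3) ∧ (∀ j, Matched m (a j) ↔ j = i ∨ j = k) ∧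
            (e = (s, 0) → i = 0)) ∧ (e.1 = s → e.2 ≠ 2) ∧
          ∀ Q ∈ 𝒬, ∃ d ∈ Q, d.1 ∈ A ∧ Matched m d)) := by
  refine half_of_four_cut F.cubic F.conn F.subset F.hs F.ht F.hst F.inj F.enum F.card_left
    F.card_right F.no_three_cut (F.ih _ · ?_) hQ hQA hone he
  have h1 := Finset.card_sdiff_add_card_eq_card F.subset
  have h2 := F.card_right
  rw [card_insert_of_notMem (by simp [F.hst, F.hs]), card_insert_of_notMem F.ht.2]
  omega

lemma half_empty (F : FourCut S τ A a s t)
    {𝒬 : Set (Set (V × Fin 3))} (hQ : IsFamily S τ 𝒬) (hQA : ∀ Q ∈ 𝒬, ∃ d ∈ Q, d.1 ∈ A)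
    (hone : ∀ O ∈ 𝒬, ∀ O' ∈ 𝒬, ∀ i j, a i ∈ O → a j ∈ O' → O = O') {i j : Fin 4} (hij : i ≠ j)
    (hi : ∀ Q ∈ 𝒬, a i ∉ Q) (hj : ∀ Q ∈ 𝒬, a j ∉ Q) :
    ∃ m, HalfPM A τ m ∧ (∀ k, ¬ Matched m (a k)) ∧ ∀ Q ∈ 𝒬, ∃ d ∈ Q, d.1 ∈ A ∧ Matched m d := by
  have perm : ∀ i k : Fin 4, i ≠ k → ∃ σ : Equiv.Perm (Fin 4), σ 0 = i ∧ σ 1 = k := by decide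
  obtain ⟨σ, rfl, rfl⟩ := perm i j hij
  obtain ⟨m, hm, -, ⟨h1, -, h3⟩ | ⟨-, h2, -⟩⟩ := (F.perm σ).half hQ hQA
    (fun O hO O' hO' i j => hone O hO O' hO' _ _) (e := (s, 2))
    (.inr ⟨rfl, fun Q hQ => ⟨hi Q hQ, hj Q hQ⟩⟩)
  · refine ⟨m, hm, fun k => by simpa using h1 (σ.symm k), fun Q hQQ => ?_⟩
    have := h3 Q hQQ
    have := hi Q hQQ
    have := hj Q hQQ
    tauto
  · exact absurd rfl (h2 rfl)

lemma half_pair (F : FourCut S τ A a s t)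
    {𝒬 : Set (Set (V × Fin 3))} (hQ : IsFamily S τ 𝒬) (hQA : ∀ Q ∈ 𝒬, ∃ d ∈ Q, d.1 ∈ A)
    (hone : ∀ O ∈ 𝒬, ∀ O' ∈ 𝒬, ∀ i j, a i ∈ O → a j ∈ O' → O = O') {i k l : Fin 4} (hik : i ≠ k)
    (hil : i ≠ l) (hkl : k ≠ l)
    (hi : (∀ Q ∈ 𝒬, ∀ j, a j ∉ Q) ∨ ∀ Q ∈ 𝒬, ∀ r, ((a i).1, r) ∉ Q) :
    ∃ m, HalfPM A τ m ∧ ((∀ j, Matched m (a j) ↔ j = i ∨ j = k) ∨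
      ∀ j, Matched m (a j) ↔ j = i ∨ j = l) ∧ (∀ Q ∈ 𝒬, ∃ d ∈ Q, d.1 ∈ A ∧ Matched m d) ∧
      Matched m (a i) := by
  have perm : ∀ i k l : Fin 4, i ≠ k → i ≠ l → k ≠ l →
      ∃ σ : Equiv.Perm (Fin 4), σ 0 = i ∧ σ 2 = k ∧ σ 3 = l := by decide
  obtain ⟨σ, rfl, rfl, rfl⟩ := perm i k l hik hil hkl
  have main : ∃ m, HalfPM A τ m ∧ (∃ k, (k = 2 ∨ k = 3) ∧
      ∀ j, Matched m (a (σ j)) ↔ j = 0 ∨ j = k) ∧ ∀ Q ∈ 𝒬, ∃ d ∈ Q, d.1 ∈ A ∧ Matched m d := by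
    rcases hi with hi | hi
    · obtain ⟨m, hm, -, ⟨-, h2, -⟩ | ⟨⟨i, k, -, hk, hm2, hi⟩, -, h3⟩⟩ := (F.perm σ).half hQ hQA
        (fun O hO O' hO' i j => hone O hO O' hO' _ _) (e := (s, 0))
        (.inr ⟨rfl, fun Q hQ => ⟨hi Q hQ _, hi Q hQ _⟩⟩)
      · exact absurd (h2 rfl) (by simp)
      · obtain rfl := hi rfl
        exact ⟨m, hm, ⟨k, hk, hm2⟩, h3⟩
    · obtain ⟨m, hm, hme, ⟨h2, -⟩ | ⟨⟨i, k, -, hk, hm2, -⟩, -, h3⟩⟩ := (F.perm σ).half hQ hQA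
        (fun O hO O' hO' i j => hone O hO O' hO' _ _) (e := a (σ 0))
        (.inl ⟨F.mem_left _, hi⟩)
      · exact absurd (hme (F.mem_left _)) (h2 _)
      · have h0 := (hm2 0).1 (hme (F.mem_left _))
        have hi0 : i = 0 := by
          rcases h0 with rfl | rfl
          · rfl
          · exact absurd hk (by decide)
        rw [hi0] at hm2
        exact ⟨m, hm, ⟨k, hk, hm2⟩, h3⟩
  obtain ⟨m, hm, ⟨k, hk, hmk⟩, hmQ⟩ := main
  have hmk' : ∀ j, Matched m (a j) ↔ j = σ 0 ∨ j = σ k := by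
    intro j
    have := hmk (σ.symm j)
    simpa [Equiv.symm_apply_eq] using this
  refine ⟨m, hm, ?_, hmQ, (hmk' _).2 (.inl rfl)⟩
  rcases hk with rfl | rfl
  · exact .inl hmk'
  · exact .inr hmk'

end FourCut

lemma exists_isPM_of_halves {A : Finset V} {m₁ m₂ : V → Fin 3} (h : IsCubicMap S τ)
    {𝒪 : Set (Set (V × Fin 3))} {e : V × Fin 3} (h1 : HalfPM A τ m₁) (h2 : HalfPM (S \ A) τ m₂)
    (h12 : ∀ d ∈ cut τ A, Matched m₁ d ↔ Matched m₂ (τ d)) (heA : e.1 ∈ A) (hme : Matched m₁ e)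
    (hO : ∀ O ∈ 𝒪, (∃ d ∈ O, d.1 ∈ A ∧ Matched m₁ d) ∨ ∃ d ∈ O, d.1 ∈ S \ A ∧ Matched m₂ d) :
    ∃ m, IsPM S τ m ∧ Matched m e ∧ ∀ O ∈ 𝒪, ∃ d ∈ O, Matched m d := by
  refine ⟨_, isPM_glue h h1 h2 h12, ?_, fun O hOO => ?_⟩
  · simpa [Matched, heA] using hme
  · rcases hO O hOO with ⟨d, hd, hdA, hdm⟩ | ⟨d, hd, hdA, hdm⟩
    · exact ⟨d, hd, by simpa [Matched, hdA] using hdm⟩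
    · exact ⟨d, hd, by simpa [Matched, (mem_sdiff.1 hdA).2] using hdm⟩

namespace FourCut

variable {A : Finset V} {a : Fin 4 → V × Fin 3} {s t : V} {𝒪 : Set (Set (V × Fin 3))}

lemma half_left (F : FourCut S τ A a s t) (hF : IsFamily S τ 𝒪) {e : V × Fin 3} (he : e.1 ∈ A)
    (hunc : ∀ O ∈ 𝒪, ∀ i, (e.1, i) ∉ O) (σ : Equiv.Perm (Fin 4)) :
    ∃ m, HalfPM A τ m ∧ Matched m e ∧
      (∀ O ∈ 𝒪, (∀ j, a j ∉ O) → (∃ d ∈ O, d.1 ∈ A) → ∃ d ∈ O, d.1 ∈ A ∧ Matched m d) ∧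
      ((∀ j, ¬ Matched m (a j)) ∧ ({O ∈ 𝒪 | ∃ j, a j ∈ O}.Nonempty →
          (∃ d ∈ ⋃₀ {O ∈ 𝒪 | ∃ j, a j ∈ O}, d.1 ∈ A ∧ Matched m d) ∨
          ¬ (a (σ 0) ∈ ⋃₀ {O ∈ 𝒪 | ∃ j, a j ∈ O} ↔ a (σ 1) ∈ ⋃₀ {O ∈ 𝒪 | ∃ j, a j ∈ O})) ∨
        (∃ i k, (i = 0 ∨ i = 1) ∧ (k = 2 ∨ k = 3) ∧
          ∀ j, Matched m (a j) ↔ j = σ i ∨ j = σ k) ∧ ({O ∈ 𝒪 | ∃ j, a j ∈ O}.Nonempty →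
          ∃ d ∈ ⋃₀ {O ∈ 𝒪 | ∃ j, a j ∈ O}, d.1 ∈ A ∧ Matched m d)) := by
  set 𝒞 := {O ∈ 𝒪 | ∃ j, a j ∈ O} with h𝒞
  set 𝒜 := {O ∈ 𝒪 | (∀ j, a j ∉ O) ∧ ∃ d ∈ O, d.1 ∈ A} with h𝒜
  have h𝒞F : IsFamily S τ 𝒞 := hF.mono fun O hO => hO.1
  have hfam : IsFamily S τ (𝒜 ∪ {Ω | 𝒞.Nonempty ∧ Ω = ⋃₀ 𝒞}) := by
    have hdis : ∀ O ∈ 𝒜, Disjoint O (⋃₀ 𝒞) := by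
      rintro O ⟨hO, hO1, -⟩
      rw [Set.disjoint_sUnion_right]
      rintro O' ⟨hO', j, hj⟩
      exact hF.2 hO hO' (by rintro rfl; exact hO1 j hj)
    constructor
    · rintro O (hO | ⟨hne, rfl⟩)
      · exact hF.1 O hO.1
      · exact h𝒞F.sUnion hne
    · rintro O (hO | ⟨hne, rfl⟩) O' (hO' | ⟨hne', rfl⟩) hOO
      · exact hF.2 hO.1 hO'.1 hOO
      · exact hdis O hO
      · exact (hdis O' hO').symm
      · exact absurd rfl hOO
  obtain ⟨m, hm, hme, hpat⟩ := (F.perm σ).half hfam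
    (by
      rintro O (hO | ⟨⟨O', hO', j, hj⟩, rfl⟩)
      · exact hO.2.2
      · exact ⟨a j, ⟨O', ⟨hO', j, hj⟩, hj⟩, F.mem_left j⟩)
    (by
      rintro O (hO | ⟨-, rfl⟩) O' (hO' | ⟨-, rfl⟩) i j hi hj
      · exact absurd hi (hO.2.1 _)
      · exact absurd hi (hO.2.1 _)
      · exact absurd hj (hO'.2.1 _)
      · rfl)
    (e := e)
    (.inl ⟨he, by
      rintro O (hO | ⟨-, rfl⟩) i
      · exact hunc O hO.1 i
      · rintro ⟨O', hO', hi⟩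
        exact hunc O' hO'.1 i hi⟩)
  refine ⟨m, hm, hme he, ?_, ?_⟩
  · intro O hO hO1 hO2
    rcases hpat with hpat | hpat
    · exact (hpat.2.2 O (.inl ⟨hO, hO1, hO2⟩)).resolve_right (by simp [hO1])
    · exact hpat.2.2 O (.inl ⟨hO, hO1, hO2⟩)
  · rcases hpat with hpat | hpat
    · left
      exact ⟨fun j => by simpa using hpat.1 (σ.symm j), fun hne => hpat.2.2 _ (.inr ⟨hne, rfl⟩)⟩
    · right
      obtain ⟨⟨i, k, hi, hk, hik, -⟩, -, hQ⟩ := hpat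
      refine ⟨⟨i, k, hi, hk, fun j => ?_⟩, fun hne => hQ _ (.inr ⟨hne, rfl⟩)⟩
      have := hik (σ.symm j)
      simpa [Equiv.symm_apply_eq] using this

lemma eq_of_uncovered (F : FourCut S τ A a s t) (hF : IsFamily S τ 𝒪) {r : Fin 4}
    (hr : ∀ O ∈ 𝒪, a r ∉ O) {O O' : Set (V × Fin 3)} (hO : O ∈ 𝒪) (hO' : O' ∈ 𝒪) {j j' : Fin 4}
    (hj : a j ∈ O) (hj' : a j' ∈ O') : O = O' := by
  by_contra hne
  have c1 := two_le_card_ports F.cubic F.subset F.inj F.enum hF hO hj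
  have c2 := two_le_card_ports F.cubic F.subset F.inj F.enum hF hO' hj'
  have d1 := disjoint_ports (a := a) hF hO hO' hne
  have h2 : ((univ.filter fun j => a j ∈ O) ∪ (univ.filter fun j => a j ∈ O')).card <
      (univ : Finset (Fin 4)).card :=
    card_lt_card ⟨subset_univ _, fun hsub => by
      have := hsub (mem_univ r)
      simp [hr O hO, hr O' hO'] at this⟩
  rw [card_union_of_disjoint d1, card_univ, Fintype.card_fin] at h2
  omega

/-- If the half of the matching in `A` avoids the cut, then at most one crossing member of the
family is not met by it, and this member misses two of the cut edges. -/
lemma missed_crossing (F : FourCut S τ A a s t) (hF : IsFamily S τ 𝒪) {m : V → Fin 3}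
    {σ : Equiv.Perm (Fin 4)}
    (hm : {O ∈ 𝒪 | ∃ j, a j ∈ O}.Nonempty →
          (∃ d ∈ ⋃₀ {O ∈ 𝒪 | ∃ j, a j ∈ O}, d.1 ∈ A ∧ Matched m d) ∨
          ¬ (a (σ 0) ∈ ⋃₀ {O ∈ 𝒪 | ∃ j, a j ∈ O} ↔ a (σ 1) ∈ ⋃₀ {O ∈ 𝒪 | ∃ j, a j ∈ O})) :
    ∃ i j, i ≠ j ∧ ∀ O ∈ 𝒪, (∃ j, a j ∈ O) → (¬ ∃ d ∈ O, d.1 ∈ A ∧ Matched m d) →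
      a i ∉ O ∧ a j ∉ O ∧ ∀ O' ∈ 𝒪, (∃ j, a j ∈ O') → (¬ ∃ d ∈ O', d.1 ∈ A ∧ Matched m d) →
        O = O' := by
  by_cases hex : ∃ O ∈ 𝒪, (∃ j, a j ∈ O) ∧ ¬ ∃ d ∈ O, d.1 ∈ A ∧ Matched m d
  swap
  · refine ⟨0, 1, by decide, fun O hO h1 h2 => absurd ⟨O, hO, h1, h2⟩ hex⟩
  obtain ⟨O, hO, ⟨j, hj⟩, hmiss⟩ := hex
  have c1 := two_le_card_ports F.cubic F.subset F.inj F.enum hF hO hj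
  suffices hs : (univ.filter fun j => a j ∈ O).card ≤ 2 ∧
      ∀ O' ∈ 𝒪, (∃ j, a j ∈ O') → (¬ ∃ d ∈ O', d.1 ∈ A ∧ Matched m d) → O = O' by
    obtain ⟨i, k, hik, hi, hk⟩ := exists_two_notMem _ rfl hs.1
    refine ⟨i, k, hik, fun O₁ hO₁ hc hm => ?_⟩
    obtain rfl := hs.2 O₁ hO₁ hc hm
    exact ⟨by simpa using hi, by simpa using hk, hs.2⟩
  rcases hm ⟨O, hO, j, hj⟩ with ⟨d, ⟨O₁, ⟨hO₁, j₁, hj₁⟩, hd⟩, hdA, hdm⟩ | hxor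
  · have hne : O₁ ≠ O := by
      rintro rfl
      exact hmiss ⟨d, hd, hdA, hdm⟩
    have c2 := two_le_card_ports F.cubic F.subset F.inj F.enum hF hO₁ hj₁
    have d1 := disjoint_ports (a := a) hF hO₁ hO hne
    have e1 := card_le_univ ((univ.filter fun j => a j ∈ O₁) ∪ (univ.filter fun j => a j ∈ O))
    rw [card_union_of_disjoint d1, Fintype.card_fin] at e1
    refine ⟨by omega, ?_⟩
    rintro O' hO' ⟨j', hj'⟩ hmiss'
    refine eq_of_crossing F.cubic F.subset F.inj F.enum hF hO₁ hO hO' hj₁ hj hj' hne ?_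
    rintro rfl
    exact hmiss' ⟨d, hd, hdA, hdm⟩
  · obtain ⟨r, hr⟩ : ∃ r, a r ∉ ⋃₀ {O ∈ 𝒪 | ∃ j, a j ∈ O} := by
      by_contra! hall
      exact hxor (by simp only [hall])
    have hr' : ∀ O' ∈ 𝒪, r ∉ univ.filter fun j => a j ∈ O' := by
      intro O' hO' hj
      simp only [mem_filter, mem_univ, true_and] at hj
      exact hr ⟨O', ⟨hO', r, hj⟩, hj⟩
    constructor
    · have h1 := (hF.1 O hO).even_card_ports F.cubic F.subset F.inj F.enum
      have h2 : (univ.filter fun j => a j ∈ O).card < (univ : Finset (Fin 4)).card :=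
        card_lt_card ⟨subset_univ _, fun hsub => hr' O hO (hsub (mem_univ r))⟩
      rw [card_univ, Fintype.card_fin] at h2
      obtain ⟨q, hq⟩ := h1
      omega
    · rintro O' hO' ⟨j', hj'⟩ -
      exact F.eq_of_uncovered hF (fun O hO => by simpa using hr' O hO) hO hO' hj hj'

end FourCut

namespace FourCut

variable {A : Finset V} {a : Fin 4 → V × Fin 3} {s t : V} {𝒪 : Set (Set (V × Fin 3))}

lemma mem_flip_iff (F : FourCut S τ A a s t) (hF : IsFamily S τ 𝒪) {O : Set (V × Fin 3)}
    (hO : O ∈ 𝒪) (j : Fin 4) : τ (a j) ∈ O ↔ a j ∈ O := by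
  constructor
  · intro hj
    have := (hF.1 O hO).2.2.1 _ hj
    rwa [(F.cubic _ (F.subset (F.mem_left j))).2.1] at this
  · exact (hF.1 O hO).2.2.1 _

lemma flip_mem_right (F : FourCut S τ A a s t) (j : Fin 4) : (τ (a j)).1 ∈ S \ A :=
  mem_sdiff.2 ⟨(F.cubic _ (F.subset (F.mem_left j))).1, F.notMem_right j⟩

lemma exists_isPM (F : FourCut S τ A a s t) (hF : IsFamily S τ 𝒪) {e : V × Fin 3} (he : e.1 ∈ A)
    (hunc : ∀ O ∈ 𝒪, ∀ i, (e.1, i) ∉ O) :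
    ∃ m, IsPM S τ m ∧ Matched m e ∧ ∀ O ∈ 𝒪, ∃ d ∈ O, Matched m d := by
  obtain ⟨s', hs', t', ht', hst'⟩ := (Finset.one_lt_card (s := A)).1 (by have := F.card_left; omega)
  have F' := F.compl hs' ht' hst'
  have inB : ∀ O ∈ 𝒪, (¬ ∃ d ∈ O, d.1 ∈ A) → ∃ d ∈ O, d.1 ∈ S \ A := by
    intro O hO hno
    obtain ⟨d, hd⟩ := (hF.1 O hO).1
    exact ⟨d, hd, mem_sdiff.2 ⟨(hF.1 O hO).2.1 d hd, fun h => hno ⟨d, hd, h⟩⟩⟩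
  have crossB : ∀ O ∈ 𝒪, ∀ j, a j ∈ O → ∃ d ∈ O, d.1 ∈ S \ A := fun O hO j hj =>
    ⟨τ (a j), (F.mem_flip_iff hF hO j).2 hj, F.flip_mem_right j⟩
  have glue : ∀ m₁ m₂, HalfPM A τ m₁ → HalfPM (S \ A) τ m₂ → Matched m₁ e →
      (∀ j, Matched m₁ (a j) ↔ Matched m₂ (τ (a j))) →
      (∀ O ∈ 𝒪, (∃ d ∈ O, d.1 ∈ A ∧ Matched m₁ d) ∨ ∃ d ∈ O, d.1 ∈ S \ A ∧ Matched m₂ d) →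
      ∃ m, IsPM S τ m ∧ Matched m e ∧ ∀ O ∈ 𝒪, ∃ d ∈ O, Matched m d := by
    intro m₁ m₂ h1 h2 hme h12 hO
    refine exists_isPM_of_halves F.cubic h1 h2 (fun d hd => ?_) he hme hO
    obtain ⟨j, rfl⟩ := (F.enum d).1 hd
    exact h12 j
  by_cases hE : ∃ (m : V → Fin 3) (σ : Equiv.Perm (Fin 4)), HalfPM A τ m ∧ Matched m e ∧
      (∀ O ∈ 𝒪, (∀ j, a j ∉ O) → (∃ d ∈ O, d.1 ∈ A) → ∃ d ∈ O, d.1 ∈ A ∧ Matched m d) ∧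
      (∀ j, ¬ Matched m (a j)) ∧ ({O ∈ 𝒪 | ∃ j, a j ∈ O}.Nonempty →
          (∃ d ∈ ⋃₀ {O ∈ 𝒪 | ∃ j, a j ∈ O}, d.1 ∈ A ∧ Matched m d) ∨
          ¬ (a (σ 0) ∈ ⋃₀ {O ∈ 𝒪 | ∃ j, a j ∈ O} ↔ a (σ 1) ∈ ⋃₀ {O ∈ 𝒪 | ∃ j, a j ∈ O}))
  · obtain ⟨m₁, σ, hm1, hme, hmA, hmno, hmC⟩ := hE
    obtain ⟨i, k, hik, hmiss⟩ := F.missed_crossing hF hmC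
    obtain ⟨m₂, hm2, hm2no, hm2O⟩ := F'.half_empty
      (hF.mono (𝒪' := {O ∈ 𝒪 | ¬ ∃ d ∈ O, d.1 ∈ A ∧ Matched m₁ d}) fun O hO => hO.1)
      (by
        rintro O ⟨hO, hOm⟩
        by_cases hcr : ∃ j, a j ∈ O
        · obtain ⟨j, hj⟩ := hcr
          exact crossB O hO j hj
        · push Not at hcr
          exact inB O hO fun hd => hOm (hmA O hO hcr hd))
      (by
        rintro O ⟨hO, hOm⟩ O' ⟨hO', hOm'⟩ j j' hj hj'
        rw [F.mem_flip_iff hF hO] at hj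
        rw [F.mem_flip_iff hF hO'] at hj'
        exact (hmiss O hO ⟨j, hj⟩ hOm).2.2 O' hO' ⟨j', hj'⟩ hOm')
      hik
      (by
        rintro O ⟨hO, hOm⟩ hi
        rw [F.mem_flip_iff hF hO] at hi
        exact (hmiss O hO ⟨_, hi⟩ hOm).1 hi)
      (by
        rintro O ⟨hO, hOm⟩ hi
        rw [F.mem_flip_iff hF hO] at hi
        exact (hmiss O hO ⟨_, hi⟩ hOm).2.1 hi)
    refine glue m₁ m₂ hm1 hm2 hme (fun j => iff_of_false (hmno j) (hm2no j)) fun O hO => ?_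
    by_cases hOm : ∃ d ∈ O, d.1 ∈ A ∧ Matched m₁ d
    · exact .inl hOm
    · exact .inr (hm2O O ⟨hO, hOm⟩)
  have hL : ∀ σ : Equiv.Perm (Fin 4), ∃ i k, (i = 0 ∨ i = 1) ∧ (k = 2 ∨ k = 3) ∧
      ∃ m, HalfPM A τ m ∧ Matched m e ∧
      (∀ O ∈ 𝒪, (∀ j, a j ∉ O) → (∃ d ∈ O, d.1 ∈ A) → ∃ d ∈ O, d.1 ∈ A ∧ Matched m d) ∧
      (∀ j, Matched m (a j) ↔ j = σ i ∨ j = σ k) ∧ ({O ∈ 𝒪 | ∃ j, a j ∈ O}.Nonempty →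
          ∃ d ∈ ⋃₀ {O ∈ 𝒪 | ∃ j, a j ∈ O}, d.1 ∈ A ∧ Matched m d) := by
    intro σ
    obtain ⟨m, h1, h2, h3, ⟨h4, h5⟩ | ⟨⟨i, k, hi, hk, h4⟩, h5⟩⟩ := F.half_left hF he hunc σ
    · exact absurd ⟨m, σ, h1, h2, h3, h4, h5⟩ hE
    · exact ⟨i, k, hi, hk, m, h1, h2, h3, h4, h5⟩
  by_cases hcov : ∀ j, ∃ O ∈ 𝒪, a j ∈ O
  · obtain ⟨i, k, ⟨m₁, hm1, hme, hmA, hmp, -⟩, m₂, hm2, hm2p, hm2O⟩ := exists_common_pair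
      (P := fun i k => ∃ m, HalfPM A τ m ∧ Matched m e ∧
        (∀ O ∈ 𝒪, (∀ j, a j ∉ O) → (∃ d ∈ O, d.1 ∈ A) → ∃ d ∈ O, d.1 ∈ A ∧ Matched m d) ∧
        (∀ j, Matched m (a j) ↔ j = i ∨ j = k) ∧ ({O ∈ 𝒪 | ∃ j, a j ∈ O}.Nonempty →
          ∃ d ∈ ⋃₀ {O ∈ 𝒪 | ∃ j, a j ∈ O}, d.1 ∈ A ∧ Matched m d))
      (Q := fun i k => ∃ m, HalfPM (S \ A) τ m ∧ (∀ j, Matched m (τ (a j)) ↔ j = i ∨ j = k) ∧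
        ∀ O ∈ 𝒪, (∃ d ∈ O, d.1 ∈ S \ A) → ∃ d ∈ O, d.1 ∈ S \ A ∧ Matched m d)
      hL
      (by
        intro i k l hik hil hkl
        obtain ⟨O₁, hO₁, hi⟩ := hcov i
        have hi' := (F.mem_flip_iff hF hO₁ i).2 hi
        obtain ⟨m, hm, hmp, hmO, hmi⟩ := F'.half_pair
          (hF.mono (𝒪' := {O ∈ 𝒪 | (∃ d ∈ O, d.1 ∈ S \ A) ∧ O ≠ O₁}) fun O hO => hO.1)
          (fun O hO => hO.2.1)
          (by
            rintro O ⟨hO, -, hne⟩ O' ⟨hO', -, hne'⟩ j j' hj hj'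
            rw [F.mem_flip_iff hF hO] at hj
            rw [F.mem_flip_iff hF hO'] at hj'
            exact eq_of_crossing F.cubic F.subset F.inj F.enum hF hO₁ hO hO' hi hj hj' hne.symm
              hne'.symm)
          hik hil hkl
          (.inr (by
            rintro O ⟨hO, -, hne⟩ r hr
            exact hne (hF.eq_of_mem hO hO₁ hr hi')))
        have hmO' : ∀ O ∈ 𝒪, (∃ d ∈ O, d.1 ∈ S \ A) → ∃ d ∈ O, d.1 ∈ S \ A ∧ Matched m d := by
          intro O hO hOB
          by_cases hne : O = O₁
          · rw [hne]
            exact ⟨_, hi', F.flip_mem_right i, hmi⟩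
          · exact hmO O ⟨hO, hOB, hne⟩
        exact hmp.imp (fun hp => ⟨m, hm, hp, hmO'⟩) (fun hp => ⟨m, hm, hp, hmO'⟩))
      (fun i k ⟨m, h1, h2, h3⟩ => ⟨m, h1, fun j => by rw [h2 j, or_comm], h3⟩)
    refine glue m₁ m₂ hm1 hm2 hme (fun j => by rw [hmp, hm2p]) fun O hO => ?_
    by_cases hOB : ∃ d ∈ O, d.1 ∈ S \ A
    · exact .inr (hm2O O hO hOB)
    · refine .inl (hmA O hO (fun j hj => hOB (crossB O hO j hj)) ?_)
      by_contra hOA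
      exact hOB (inB O hO hOA)
  · push Not at hcov
    obtain ⟨r, hr⟩ := hcov
    obtain ⟨i, k, ⟨m₁, hm1, hme, hmA, hmp, hmC⟩, m₂, hm2, hm2p, hm2O⟩ := exists_common_pair
      (P := fun i k => ∃ m, HalfPM A τ m ∧ Matched m e ∧
        (∀ O ∈ 𝒪, (∀ j, a j ∉ O) → (∃ d ∈ O, d.1 ∈ A) → ∃ d ∈ O, d.1 ∈ A ∧ Matched m d) ∧
        (∀ j, Matched m (a j) ↔ j = i ∨ j = k) ∧ ({O ∈ 𝒪 | ∃ j, a j ∈ O}.Nonempty →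
          ∃ d ∈ ⋃₀ {O ∈ 𝒪 | ∃ j, a j ∈ O}, d.1 ∈ A ∧ Matched m d))
      (Q := fun i k => ∃ m, HalfPM (S \ A) τ m ∧ (∀ j, Matched m (τ (a j)) ↔ j = i ∨ j = k) ∧
        ∀ O ∈ 𝒪, (∀ j, a j ∉ O) → (∃ d ∈ O, d.1 ∈ S \ A) → ∃ d ∈ O, d.1 ∈ S \ A ∧ Matched m d)
      hL
      (by
        intro i k l hik hil hkl
        obtain ⟨m, hm, hmp, hmO, hmi⟩ := F'.half_pair
          (hF.mono (𝒪' := {O ∈ 𝒪 | (∀ j, a j ∉ O) ∧ ∃ d ∈ O, d.1 ∈ S \ A}) fun O hO => hO.1)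
          (fun O hO => hO.2.2)
          (by
            rintro O ⟨hO, hno, -⟩ O' - j j' hj -
            rw [F.mem_flip_iff hF hO] at hj
            exact absurd hj (hno j))
          hik hil hkl
          (.inl (by
            rintro O ⟨hO, hno, -⟩ j
            rw [F.mem_flip_iff hF hO]
            exact hno j))
        have hmO' : ∀ O ∈ 𝒪, (∀ j, a j ∉ O) → (∃ d ∈ O, d.1 ∈ S \ A) →
            ∃ d ∈ O, d.1 ∈ S \ A ∧ Matched m d := fun O hO h1 h2 => hmO O ⟨hO, h1, h2⟩
        exact hmp.imp (fun hp => ⟨m, hm, hp, hmO'⟩) (fun hp => ⟨m, hm, hp, hmO'⟩))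
      (fun i k ⟨m, h1, h2, h3⟩ => ⟨m, h1, fun j => by rw [h2 j, or_comm], h3⟩)
    refine glue m₁ m₂ hm1 hm2 hme (fun j => by rw [hmp, hm2p]) fun O hO => ?_
    by_cases hcr : ∃ j, a j ∈ O
    · obtain ⟨j, hj⟩ := hcr
      obtain ⟨d, ⟨O', ⟨hO', j', hj'⟩, hd⟩, hdA, hdm⟩ := hmC ⟨O, hO, j, hj⟩
      rw [F.eq_of_uncovered hF hr hO' hO hj' hj] at hd
      exact .inl ⟨d, hd, hdA, hdm⟩
    · push Not at hcr
      by_cases hOA : ∃ d ∈ O, d.1 ∈ A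
      · exact .inl (hmA O hO hcr hOA)
      · exact .inr (hm2O O hO hcr (inB O hO hOA))

end FourCut

lemma good_of_four_cut (h : IsCubicMap S τ) (hc : EdgeConn3 S τ) (hX : X ⊆ S)
    (hcut : (cut τ X).card = 4) (h1 : 3 ≤ X.card) (h2 : 3 ≤ (S \ X).card)
    (hnc : ∀ X ⊆ S, (cut τ X).card = 3 → X.card ≤ 1 ∨ (S \ X).card ≤ 1)
    (IH : ∀ (S' : Finset V) τ', S'.card < S.card → IsCubicMap S' τ' → EdgeConn3 S' τ' →
      Good S' τ') : Good S τ := by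
  intro 𝒪 hF e he hunc
  have key : ∀ A ⊆ S, (cut τ A).card = 4 → 3 ≤ A.card → 3 ≤ (S \ A).card → e.1 ∈ A →
      ∃ m, IsPM S τ m ∧ Matched m e ∧ ∀ O ∈ 𝒪, ∃ d ∈ O, Matched m d := by
    intro A hA hcut h1 h2 heA
    obtain ⟨a, ha, hca⟩ := exists_enum _ hcut
    obtain ⟨s, hs, t, ht, hst⟩ := (Finset.one_lt_card (s := S \ A)).1 (by omega)
    exact FourCut.exists_isPM (s := s) (t := t)
      ⟨h, hc, hA, mem_sdiff.1 hs, mem_sdiff.1 ht, hst, ha, hca, h1, h2, hnc, IH⟩ hF heA hunc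
  by_cases heX : e.1 ∈ X
  · exact key X hX hcut h1 h2 heX
  · refine key (S \ X) sdiff_subset (by rw [card_cut_sdiff h hX, hcut]) h2 ?_ (by simp [he, heX])
    rwa [Finset.sdiff_sdiff_eq_self hX]

/-- The map obtained by deleting `P` and joining the loose ends along `σ`. -/
noncomputable def rejoin (τ σ : V × Fin 3 → V × Fin 3) (P : Finset V) (d : V × Fin 3) :
    V × Fin 3 :=
  if (τ d).1 ∈ P then τ (σ (τ d)) else τ d

lemma rejoin_isCubicMap (h : IsCubicMap S τ) {P : Finset V} (hP : P ⊆ S)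
    {σ : V × Fin 3 → V × Fin 3}
    (hσ : ∀ d ∈ cut τ P, σ d ∈ cut τ P ∧ σ (σ d) = d ∧ σ d ≠ d) :
    IsCubicMap (S \ P) (rejoin τ σ P) := by
  intro d hd
  rw [mem_sdiff] at hd
  have h1 := h d hd.1
  by_cases hdP : (τ d).1 ∈ P
  · have h2 : τ d ∈ cut τ P := mem_cut.2 ⟨hdP, by rw [h1.2.1]; exact hd.2⟩
    have h3 := hσ _ h2
    have h4 := mem_cut.1 h3.1
    have h5 := h _ (hP h4.1)
    have h6 : rejoin τ σ P d = τ (σ (τ d)) := if_pos hdP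
    have h7 : rejoin τ σ P (τ (σ (τ d))) = d := by
      rw [rejoin, h5.2.1, if_pos h4.1, h3.2.1, h1.2.1]
    rw [h6, h7]
    refine ⟨mem_sdiff.2 ⟨h5.1, h4.2⟩, rfl, fun h8 => h3.2.2 ?_⟩
    rw [← h5.2.1, h8]
  · have h6 : rejoin τ σ P d = τ d := if_neg hdP
    have h7 : rejoin τ σ P (τ d) = d := by
      rw [rejoin, h1.2.1, if_neg hd.2]
    rw [h6, h7]
    exact ⟨mem_sdiff.2 ⟨h1.1, hdP⟩, rfl, h1.2.2⟩

lemma rejoin_edgeConn3 (h : IsCubicMap S τ) (hc : EdgeConn3 S τ) (hT : Tight S τ)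
    {P : Finset V} (hP : P ⊆ S) (hP2 : 2 ≤ P.card) (hout : (cut τ P).card ≤ 6)
    {σ : V × Fin 3 → V × Fin 3}
    (hσ : ∀ d ∈ cut τ P, σ d ∈ cut τ P ∧ σ (σ d) = d ∧ σ d ≠ d)
    (hnc : ∀ d ∈ cut τ P, (τ d).1 ≠ (τ (σ d)).1 ∧ ¬ DAdj τ (τ d).1 (τ (σ d)).1) :
    EdgeConn3 (S \ P) (rejoin τ σ P) := by
  have hcub := rejoin_isCubicMap h hP hσ
  set q : Finset V → Finset (V × Fin 3) := fun Z =>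
    (cut τ P).filter fun d => (τ d).1 ∈ Z ∧ (τ (σ d)).1 ∈ Z with hq
  have hqe : ∀ Z, Even (q Z).card := by
    intro Z
    apply even_card_of_involution _ σ
    · intro d hd
      have := hσ d
      grind
    · intro d hd
      exact (hσ d (mem_filter.1 hd).1).2.1
    · intro d hd
      exact (hσ d (mem_filter.1 hd).1).2.2
  have hqadd : ∀ Z, (q Z).card + (q ((S \ P) \ Z)).card ≤ 6 := by
    intro Z
    rw [← Finset.card_union_of_disjoint]
    · exact (Finset.card_le_card (by grind)).trans hout
    · rw [Finset.disjoint_left]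
      grind
  have hcutq : ∀ Z ⊆ S \ P, (cut τ Z).card ≤ (cut (rejoin τ σ P) Z).card + (q Z).card := by
    intro Z hZ
    have h1 : cut τ Z ⊆ cut (rejoin τ σ P) Z ∪ (q Z).image τ := by
      intro d hd
      rw [mem_cut] at hd
      have hdS := hZ hd.1
      rw [mem_sdiff] at hdS
      have h1 := h d hdS.1
      rw [mem_union, mem_cut, mem_image]
      by_cases hdP : (τ d).1 ∈ P
      · by_cases h2 : (τ (σ (τ d))).1 ∈ Z
        · refine .inr ⟨τ d, mem_filter.2 ⟨mem_cut.2 ⟨hdP, ?_⟩, ?_, h2⟩, h1.2.1⟩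
          · rw [h1.2.1]; exact hdS.2
          · rw [h1.2.1]; exact hd.1
        · exact .inl ⟨hd.1, by rwa [rejoin, if_pos hdP]⟩
      · exact .inl ⟨hd.1, by rw [rejoin, if_neg hdP]; exact hd.2⟩
    exact (Finset.card_le_card h1).trans ((Finset.card_union_le _ _).trans
      (Nat.add_le_add_left Finset.card_image_le _))
  have key : ∀ Z ⊆ S \ P, Z.Nonempty → Z ≠ S \ P → (q Z).card ≤ 3 →
      3 ≤ (cut (rejoin τ σ P) Z).card := by
    intro Z hZ hne hne' hq3
    by_contra hlt
    have hq2 : (q Z).card ≤ 2 := by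
      obtain ⟨r, hr⟩ := hqe Z
      omega
    have h1 := hcutq Z hZ
    have hZS : Z ⊆ S := hZ.trans sdiff_subset
    have h2 : 3 ≤ (S \ Z).card := by
      have h3 : (((S \ P) \ Z) ∪ P).card ≤ (S \ Z).card := Finset.card_le_card (by grind)
      rw [Finset.card_union_of_disjoint (by rw [Finset.disjoint_left]; grind)] at h3
      have h4 : 0 < ((S \ P) \ Z).card := by
        rw [Finset.card_pos]
        by_contra h0
        rw [Finset.not_nonempty_iff_eq_empty, Finset.sdiff_eq_empty_iff_subset] at h0
        exact hne' (hZ.antisymm h0)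
      omega
    have h3 := hT Z hZS (by omega)
    have h4 := hc Z hZS hne (by rintro rfl; simp at h2)
    obtain ⟨d, hd⟩ : (q Z).Nonempty := Finset.card_pos.1 (by omega)
    rw [hq, mem_filter] at hd
    obtain ⟨hd, hu, hv⟩ := hd
    obtain ⟨huv, hadj⟩ := hnc d hd
    have h5 : Z = {(τ d).1, (τ (σ d)).1} := by
      refine (Finset.eq_of_subset_of_card_le (by grind) ?_).symm
      rw [Finset.card_pair huv]
      omega
    have hS2 : 2 ≤ S.card := hP2.trans (Finset.card_le_card hP)
    have h6 : Z ×ˢ (univ : Finset (Fin 3)) ⊆ cut τ Z := by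
      rintro ⟨x, i⟩ hx
      have hxZ : x ∈ Z := (mem_product.1 hx).1
      refine mem_cut.2 ⟨hxZ, ?_⟩
      have h7 := no_loop h hc hS2 (d := (x, i)) (hZS hxZ)
      have h8 : ∀ y, (τ (x, i)).1 = y → DAdj τ x y := fun y hy => ⟨i, hy⟩
      have h9 := h.dadj_symm (u := (τ (σ d)).1) (v := (τ d).1) (hZS hv)
      intro h10
      simp only [h5, mem_insert, mem_singleton] at hxZ h10
      rcases hxZ with rfl | rfl <;> rcases h10 with h10 | h10
      · exact h7 h10
      · exact hadj (h8 _ h10)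
      · exact hadj (h9 (h8 _ h10))
      · exact h7 h10
    have h7 := Finset.card_le_card h6
    rw [Finset.card_product, Finset.card_univ, Fintype.card_fin, h5, Finset.card_pair huv] at h7
    rw [← h5] at h7
    omega
  intro Z hZ hne hne'
  by_cases hq3 : (q Z).card ≤ 3
  · exact key Z hZ hne hne' hq3
  · rw [← card_cut_sdiff hcub hZ]
    refine key _ sdiff_subset ?_ ?_ ?_
    · by_contra h0
      rw [Finset.not_nonempty_iff_eq_empty, Finset.sdiff_eq_empty_iff_subset] at h0
      exact hne' (hZ.antisymm h0)
    · intro h0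
      obtain ⟨x, hx⟩ := hne
      have := hZ hx
      rw [← h0] at this
      exact (mem_sdiff.1 this).2 hx
    · have := hqadd Z
      omega

lemma exists_isPM_of_rejoin (h : IsCubicMap S τ) (hc : EdgeConn3 S τ) (hT : Tight S τ)
    (IH : ∀ (S' : Finset V) τ', S'.card < S.card → IsCubicMap S' τ' → EdgeConn3 S' τ' →
      Good S' τ')
    {P : Finset V} (hP : P ⊆ S) (hP2 : 2 ≤ P.card) (hout : (cut τ P).card ≤ 6)
    {σ : V × Fin 3 → V × Fin 3}
    (hσ : ∀ d ∈ cut τ P, σ d ∈ cut τ P ∧ σ (σ d) = d ∧ σ d ≠ d)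
    (hnc : ∀ d ∈ cut τ P, (τ d).1 ≠ (τ (σ d)).1 ∧ ¬ DAdj τ (τ d).1 (τ (σ d)).1)
    {𝒪 : Set (Set (V × Fin 3))} (hF : IsFamily S τ 𝒪)
    (hPO : ∀ O ∈ 𝒪, ∀ d ∈ O, d.1 ∉ P) {e : V × Fin 3} (he : e.1 ∈ S) (heP : e.1 ∉ P)
    (heP' : (τ e).1 ∉ P) (hunc : ∀ O ∈ 𝒪, ∀ i, (e.1, i) ∉ O) :
    ∃ m' : V → Fin 3, Matched m' e ∧ Matched m' (τ e) ∧
      (∀ d ∈ cut τ P, Matched m' (τ d) ↔ Matched m' (τ (σ d))) ∧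
      ∀ f, HalfPM P τ f → (∀ d ∈ cut τ P, Matched f d ↔ Matched m' (τ d)) →
        ∃ m, IsPM S τ m ∧ (∀ v ∈ P, m v = f v) ∧ Matched m e ∧ ∀ O ∈ 𝒪, ∃ d ∈ O, Matched m d := by
  have hcub := rejoin_isCubicMap h hP hσ
  have heq : ∀ d, (τ d).1 ∉ P → rejoin τ σ P d = τ d := fun d hd => if_neg hd
  obtain ⟨m', hm', hme, hmO⟩ := IH _ _ (by
      rw [Finset.card_sdiff_of_subset hP]
      have := Finset.card_le_card hP
      omega) hcub (rejoin_edgeConn3 h hc hT hP hP2 hout hσ hnc) 𝒪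
    ⟨fun O hO => by
      have h1 := hF.1 O hO
      refine ⟨h1.1, fun d hd => mem_sdiff.2 ⟨h1.2.1 d hd, hPO O hO d hd⟩, fun d hd => ?_, h1.2.2.2⟩
      rw [heq d (hPO O hO _ (h1.2.2.1 d hd))]
      exact h1.2.2.1 d hd, hF.2⟩ e (mem_sdiff.2 ⟨he, heP⟩) hunc
  have hme' : Matched m' (τ e) := by
    rw [← heq e heP']
    exact hm' e (mem_sdiff.2 ⟨he, heP⟩) hme
  have hside : ∀ d ∈ cut τ P, Matched m' (τ d) → Matched m' (τ (σ d)) := by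
    intro d hd hdm
    have h1 := mem_cut.1 hd
    have h2 := h d (hP h1.1)
    have h3 := hm' (τ d) (mem_sdiff.2 ⟨h2.1, h1.2⟩) hdm
    rwa [rejoin, h2.2.1, if_pos h1.1] at h3
  refine ⟨m', hme, hme', fun d hd => ⟨hside d hd, fun h1 => ?_⟩, fun f hf hfm =>
    ⟨_, isPM_glue h hf (m₂ := m') ?_ hfm, ?_, ?_, ?_⟩⟩
  · have h2 := hσ d hd
    have h3 := hside _ h2.1 h1
    rwa [h2.2.1] at h3
  · intro d hd hd' hdm
    rw [← heq d (mem_sdiff.1 hd').2]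
    exact hm' d hd hdm
  · intro v hv
    exact if_pos hv
  · simpa [Matched, heP] using hme
  · intro O hO
    obtain ⟨d, hd, hdm⟩ := hmO O hO
    exact ⟨d, hd, by simpa [Matched, hPO O hO d hd] using hdm⟩

/-- The darts `a`, `b`, `c` are the three darts at `x`. -/
def Star (x : V) (a b c : V × Fin 3) : Prop :=
  (a.1 = x ∧ b.1 = x ∧ c.1 = x) ∧ (a ≠ b ∧ a ≠ c ∧ b ≠ c) ∧
    ∀ d : V × Fin 3, d.1 = x → d = a ∨ d = b ∨ d = c

lemma Star.of_ne {x : V} {a b c : V × Fin 3} (ha : a.1 = x) (hb : b.1 = x) (hc : c.1 = x)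
    (hab : a ≠ b) (hac : a ≠ c) (hbc : b ≠ c) : Star x a b c := by
  refine ⟨⟨ha, hb, hc⟩, ⟨hab, hac, hbc⟩, ?_⟩
  obtain ⟨x, i⟩ := a
  obtain ⟨x₂, j⟩ := b
  obtain ⟨x₃, k⟩ := c
  rintro ⟨x₄, l⟩ hd
  have : ∀ i j k l : Fin 3, i ≠ j → i ≠ k → j ≠ k → l = i ∨ l = j ∨ l = k := by decide
  have := this i j k l
  grind

lemma exists_star (a : V × Fin 3) : ∃ b c, Star a.1 a b c := by
  refine ⟨(a.1, a.2 + 1), (a.1, a.2 + 2), Star.of_ne rfl rfl rfl ?_ ?_ ?_⟩ <;>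
  · obtain ⟨x, i⟩ := a
    have : ∀ i : Fin 3, i ≠ i + 1 ∧ i ≠ i + 2 ∧ i + 1 ≠ i + 2 := by decide
    have := this i
    simp_all

lemma dadj_of_dart {d : V × Fin 3} : DAdj τ d.1 (τ d).1 := ⟨d.2, rfl⟩

/-- The two far ends of the outer edges of a path of length three are distinct and not
adjacent. -/
lemma ne_and_not_dadj_of_path (h : IsCubicMap S τ) (hc : EdgeConn3 S τ) (hT : Tight S τ)
    (hS : 7 ≤ S.card) {a b c : V × Fin 3} (ha : a.1 ∈ S) (hab : a ≠ b) (hab' : b.1 = a.1)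
    (hca : c.1 = (τ a).1) (hc' : c ≠ τ a) :
    (τ b).1 ≠ (τ c).1 ∧ ¬ DAdj τ (τ b).1 (τ c).1 := by
  have h1 := h a ha
  have h2 := h b (hab'.symm ▸ ha)
  have h3 := h c (hca.symm ▸ h1.1)
  have e1 : DAdj τ (τ b).1 a.1 := h.dadj_symm ha (hab' ▸ dadj_of_dart)
  have e2 : DAdj τ a.1 (τ a).1 := dadj_of_dart
  have e3 : DAdj τ (τ a).1 (τ c).1 := hca ▸ dadj_of_dart
  constructor
  · intro heq
    exact no_triangle h hc hT (by omega) h2.1 e1 e2 (heq ▸ e3)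
  · intro hadj
    refine no_square h hc hT hS h2.1 e1 e2 e3 (h.dadj_symm h2.1 hadj) ?_ ?_
    · intro heq
      exact hab (no_parallel h hc (by omega) ha hab'.symm heq.symm)
    · intro heq
      have := no_parallel h hc (by omega) (d := c) (d' := τ a) (hca.symm ▸ h1.1) hca
        (by rw [h1.2.1]; exact heq.symm)
      exact hc' this

lemma exists_isPM_of_edge (h : IsCubicMap S τ) (hc : EdgeConn3 S τ) (hT : Tight S τ)
    (hS : 7 ≤ S.card)
    (IH : ∀ (S' : Finset V) τ', S'.card < S.card → IsCubicMap S' τ' → EdgeConn3 S' τ' →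
      Good S' τ')
    {x y : V} {a b c b' c' e : V × Fin 3} (hx : x ∈ S) (hsx : Star x a b c)
    (hsy : Star y (τ a) b' c')
    {𝒪 : Set (Set (V × Fin 3))} (hF : IsFamily S τ 𝒪)
    (hPO : ∀ O ∈ 𝒪, ∀ d ∈ O, d.1 ≠ x ∧ d.1 ≠ y) (he : e.1 ∈ S) (hex : e.1 ≠ x) (hey : e.1 ≠ y)
    (hb : (τ b).1 = (τ e).1) (hunc : ∀ O ∈ 𝒪, ∀ i, (e.1, i) ∉ O) :
    ∃ m, IsPM S τ m ∧ Matched m e ∧ (∀ O ∈ 𝒪, ∃ d ∈ O, Matched m d) ∧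
      (Matched m c' ∨ Matched m a) := by
  obtain ⟨⟨ha1, hb1, hc1⟩, ⟨hab, hac, hbc⟩, hx3⟩ := hsx
  obtain ⟨⟨ha'1, hb'1, hc'1⟩, ⟨hab', hac', hbc'⟩, hy3⟩ := hsy
  have hA := h a (by rw [ha1]; exact hx)
  have hy : y ∈ S := ha'1 ▸ hA.1
  have hB := h b (by rw [hb1]; exact hx)
  have hC := h c (by rw [hc1]; exact hx)
  have hB' := h b' (by rw [hb'1]; exact hy)
  have hC' := h c' (by rw [hc'1]; exact hy)
  have hE := h e he
  have hxy : x ≠ y := by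
    have := no_loop h hc (by omega) (d := a) (by rw [ha1]; exact hx)
    grind
  have nlx : ∀ d : V × Fin 3, d.1 ∈ S → (τ d).1 ≠ d.1 := fun d => no_loop h hc (by omega)
  have npx : ∀ d d' : V × Fin 3, d.1 ∈ S → d.1 = d'.1 → (τ d).1 = (τ d').1 → d = d' :=
    fun d d' => no_parallel h hc (by omega)
  have nb := ne_and_not_dadj_of_path h hc hT hS (a := a) (b := b) (c := b') (by grind) hab
    (by grind) (by grind) hab'.symm
  have nc := ne_and_not_dadj_of_path h hc hT hS (a := a) (b := c) (c := c') (by grind) hac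
    (by grind) (by grind) hac'.symm
  have outb : (τ b).1 ≠ x ∧ (τ b).1 ≠ y := by
    have := nlx b; have := npx a b; grind
  have outc : (τ c).1 ≠ x ∧ (τ c).1 ≠ y := by
    have := nlx c; have := npx a c; grind
  have outb' : (τ b').1 ≠ x ∧ (τ b').1 ≠ y := by
    have := nlx b'; have := npx (τ a) b'; grind
  have outc' : (τ c').1 ≠ x ∧ (τ c').1 ≠ y := by
    have := nlx c'; have := npx (τ a) c'; grind
  have hcut : ∀ d, d ∈ cut τ {x, y} ↔ d = b ∨ d = c ∨ d = b' ∨ d = c' := by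
    intro d
    rw [mem_cut]
    have := hx3 d
    have := hy3 d
    grind
  have hcard : (cut τ {x, y}).card ≤ 6 := by
    have : cut τ {x, y} ⊆ {b, c, b', c'} := by
      intro d hd
      simpa using (hcut d).1 hd
    exact (Finset.card_le_card this).trans (Finset.card_le_four.trans (by norm_num))
  obtain ⟨σ, hσb, hσc, hσb', hσc'⟩ : ∃ σ : V × Fin 3 → V × Fin 3,
      σ b = b' ∧ σ c = c' ∧ σ b' = b ∧ σ c' = c :=
    ⟨fun d => if d = b then b' else if d = c then c' else if d = b' then b else c, by grind⟩
  have snd_ne : ∀ d d' : V × Fin 3, d.1 = d'.1 → d ≠ d' → d.2 ≠ d'.2 :=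
    fun d d' h1 h2 h3 => h2 (Prod.ext h1 h3)
  have n1 := snd_ne a b (by grind) hab
  have n2 := snd_ne a c (by grind) hac
  have n3 := snd_ne b c (by grind) hbc
  have n4 := snd_ne (τ a) b' (by grind) hab'
  have n5 := snd_ne (τ a) c' (by grind) hac'
  have n6 := snd_ne b' c' (by grind) hbc'
  have hsym := fun (d d' : V × Fin 3) (hd : d.1 ∈ S) =>
    h.dadj_symm (u := (τ d).1) (v := (τ d').1) ((h d hd).1)
  obtain ⟨m', hm1, hm2, hm3, hm4⟩ := exists_isPM_of_rejoin h hc hT IH (P := {x, y})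
    (by grind) (by rw [Finset.card_pair hxy]) hcard (σ := σ)
    (by
      intro d hd
      rw [hcut] at hd
      rw [hcut]
      grind)
    (by
      intro d hd
      rw [hcut] at hd
      have := hsym b' b
      have := hsym c' c
      grind)
    hF (by intro O hO d hd; have := hPO O hO d hd; grind) he (by grind) (by grind) hunc
  have k1 := hm3 b ((hcut b).2 (by simp))
  have k2 := hm3 c ((hcut c).2 (by simp))
  rw [hσb] at k1
  rw [hσc] at k2
  have k3 : ¬ Matched m' (τ b) := by
    intro h1
    have h2 : τ b = τ e := by
      simp only [Matched] at h1 hm2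
      refine Prod.ext hb ?_
      rw [← h1, ← hm2, hb]
    have := h.inj (d := b) (d' := e) (by grind) he h2
    grind
  have inner : ∀ d : V × Fin 3, d.1 ∈ ({x, y} : Finset V) → (τ d).1 ∈ ({x, y} : Finset V) →
      d = a ∨ d = τ a := by
    intro d hd hd'
    rw [mem_insert, mem_singleton] at hd hd'
    rcases hd with hd | hd
    · rcases hx3 d hd with rfl | rfl | rfl
      · exact .inl rfl
      · exact absurd hd' (by simp [outb])
      · exact absurd hd' (by simp [outc])
    · rcases hy3 d hd with rfl | rfl | rfl
      · exact .inr rfl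
      · exact absurd hd' (by simp [outb'])
      · exact absurd hd' (by simp [outc'])
  by_cases hM : Matched m' (τ c)
  · obtain ⟨m, hm, hmP, hme, hmO⟩ := hm4 (fun v => if v = x then c.2 else c'.2)
      (by
        intro d hd hd' hdm
        rcases inner d hd hd' with rfl | rfl
        · simp [Matched, ha1, n2.symm] at hdm
        · simp [Matched, ha'1, hxy.symm, n5.symm] at hdm)
      (by
        intro d hd
        rw [hcut] at hd
        rcases hd with rfl | rfl | rfl | rfl
        · exact iff_of_false (by simpa [Matched, hb1] using n3.symm) k3
        · exact iff_of_true (by simp [Matched, hc1]) hM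
        · exact iff_of_false (by simpa [Matched, hb'1, hxy.symm] using n6.symm) (k3 ∘ k1.2)
        · exact iff_of_true (by simp [Matched, hc'1, hxy.symm]) (k2.1 hM))
    refine ⟨m, hm, hme, hmO, .inl ?_⟩
    rw [Matched, hc'1, hmP y (by simp), if_neg hxy.symm]
  · obtain ⟨m, hm, hmP, hme, hmO⟩ := hm4 (fun v => if v = x then a.2 else (τ a).2)
      (by
        intro d hd hd' hdm
        rcases inner d hd hd' with rfl | rfl
        · simp [Matched, ha'1, hxy.symm]
        · simp [Matched, hA.2.1, ha1])
      (by
        intro d hd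
        rw [hcut] at hd
        rcases hd with rfl | rfl | rfl | rfl
        · exact iff_of_false (by simpa [Matched, hb1] using n1) k3
        · exact iff_of_false (by simpa [Matched, hc1] using n2) hM
        · exact iff_of_false (by simpa [Matched, hb'1, hxy.symm] using n4) (k3 ∘ k1.2)
        · exact iff_of_false (by simpa [Matched, hc'1, hxy.symm] using n5) (hM ∘ k2.2))
    refine ⟨m, hm, hme, hmO, .inr ?_⟩
    rw [Matched, ha1, hmP x (by simp), if_pos rfl]

lemma Star.snd_ne {x : V} {a b c : V × Fin 3} (h : Star x a b c) :
    a.2 ≠ b.2 ∧ a.2 ≠ c.2 ∧ b.2 ≠ c.2 := by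
  obtain ⟨⟨h1, h2, h3⟩, ⟨h4, h5, h6⟩, -⟩ := h
  exact ⟨fun hh => h4 (Prod.ext (h1.trans h2.symm) hh),
    fun hh => h5 (Prod.ext (h1.trans h3.symm) hh), fun hh => h6 (Prod.ext (h2.trans h3.symm) hh)⟩

lemma exists_pairing {α : Type*} {a a' b b' c c' : α} (h₁ : a ≠ a') (h₂ : a ≠ b) (h₃ : a ≠ b')
    (h₄ : a ≠ c) (h₅ : a ≠ c') (h₆ : a' ≠ b) (h₇ : a' ≠ b') (h₈ : a' ≠ c) (h₉ : a' ≠ c')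
    (k₁ : b ≠ b') (k₂ : b ≠ c) (k₃ : b ≠ c') (k₄ : b' ≠ c) (k₅ : b' ≠ c') (k₆ : c ≠ c') :
    ∃ σ : α → α, σ a = a' ∧ σ a' = a ∧ σ b = b' ∧ σ b' = b ∧ σ c = c' ∧ σ c' = c :=
  ⟨fun d => if d = a then a' else if d = a' then a else if d = b then b' else
    if d = b' then b else if d = c then c' else c, by grind⟩

/-- A path with four vertices in a tight cubic graph is induced. -/
lemma path_cut (h : IsCubicMap S τ) (hc : EdgeConn3 S τ) (hT : Tight S τ) (hS : 7 ≤ S.card)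
    {x₁ x₂ x₃ x₄ : V} {a b b₂ g p k k' l l' : V × Fin 3} (hx : x₁ ∈ S) (h₁ : Star x₁ a b b₂)
    (h₂ : Star x₂ (τ a) g p) (h₃ : Star x₃ (τ g) k k') (h₄ : Star x₄ (τ k) l l') :
    (x₂ ∈ S ∧ x₃ ∈ S ∧ x₄ ∈ S) ∧
      (x₁ ≠ x₂ ∧ x₁ ≠ x₃ ∧ x₁ ≠ x₄ ∧ x₂ ≠ x₃ ∧ x₂ ≠ x₄ ∧ x₃ ≠ x₄) ∧
      ∀ d ∈ ({b, b₂, p, k', l, l'} : Finset (V × Fin 3)),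
        (τ d).1 ∉ ({x₁, x₂, x₃, x₄} : Finset V) := by
  obtain ⟨⟨ha1, hb1, hb21⟩, ⟨hab, hab2, hbb2⟩, -⟩ := h₁
  obtain ⟨⟨ha'1, hg1, hp1⟩, ⟨hag, hap, hgp⟩, -⟩ := h₂
  obtain ⟨⟨hg'1, hk1, hk'1⟩, ⟨hgk, hgk', hkk'⟩, -⟩ := h₃
  obtain ⟨⟨hk'1', hl1, hl'1⟩, ⟨hkl, hkl', hll'⟩, -⟩ := h₄
  have hx2 : x₂ ∈ S := ha'1 ▸ (h a (ha1.symm ▸ hx)).1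
  have hx3 : x₃ ∈ S := hg'1 ▸ (h g (hg1.symm ▸ hx2)).1
  have hx4 : x₄ ∈ S := hk'1' ▸ (h k (hk1.symm ▸ hx3)).1
  have e12 : DAdj τ x₁ x₂ := ha1 ▸ ha'1 ▸ dadj_of_dart
  have e23 : DAdj τ x₂ x₃ := hg1 ▸ hg'1 ▸ dadj_of_dart
  have e34 : DAdj τ x₃ x₄ := hk1 ▸ hk'1' ▸ dadj_of_dart
  have n12 := dadj_ne h hc (by omega) hx e12
  have n23 := dadj_ne h hc (by omega) hx2 e23
  have n34 := dadj_ne h hc (by omega) hx3 e34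
  have npx : ∀ d d' : V × Fin 3, d.1 ∈ S → d.1 = d'.1 → (τ d).1 = (τ d').1 → d = d' :=
    fun d d' => no_parallel h hc (by omega)
  have ta : (τ (τ a)).1 = x₁ := by rw [(h a (ha1.symm ▸ hx)).2.1, ha1]
  have tg : (τ (τ g)).1 = x₂ := by rw [(h g (hg1.symm ▸ hx2)).2.1, hg1]
  have tk : (τ (τ k)).1 = x₃ := by rw [(h k (hk1.symm ▸ hx3)).2.1, hk1]
  have n13 : x₁ ≠ x₃ := fun hh => hag (npx _ _ (ha'1.symm ▸ hx2) (by rw [ha'1, hg1])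
    (by rw [ta, hg'1, hh]))
  have n24 : x₂ ≠ x₄ := fun hh => hgk (npx _ _ (hg'1.symm ▸ hx3) (by rw [hg'1, hk1])
    (by rw [tg, hk'1', hh]))
  have n14 : x₁ ≠ x₄ := fun hh => no_triangle h hc hT (by omega) hx e12 e23 (hh ▸ e34)
  have f13 : ¬ DAdj τ x₃ x₁ := fun hh => no_triangle h hc hT (by omega) hx e12 e23 hh
  have f24 : ¬ DAdj τ x₄ x₂ := fun hh => no_triangle h hc hT (by omega) hx2 e23 e34 hh
  have f14 : ¬ DAdj τ x₄ x₁ := fun hh => no_square h hc hT (by omega) hx e12 e23 e34 hh n13 n24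
  have f31 : ¬ DAdj τ x₁ x₃ := fun hh => f13 (h.dadj_symm hx hh)
  have f42 : ¬ DAdj τ x₂ x₄ := fun hh => f24 (h.dadj_symm hx2 hh)
  have f41 : ¬ DAdj τ x₁ x₄ := fun hh => f14 (h.dadj_symm hx hh)
  have adj : ∀ d : V × Fin 3, ∀ x y, d.1 = x → (τ d).1 = y → DAdj τ x y := by
    rintro d x y rfl rfl
    exact dadj_of_dart
  have nl : ∀ d : V × Fin 3, ∀ x, d.1 = x → x ∈ S → (τ d).1 ≠ x := by
    rintro d x rfl hd
    exact no_loop h hc (by omega) hd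
  refine ⟨⟨hx2, hx3, hx4⟩, ⟨n12, n13, n14, n23, n24, n34⟩, ?_⟩
  have o1 : ∀ d : V × Fin 3, d.1 = x₁ → d ≠ a → (τ d).1 ∉ ({x₁, x₂, x₃, x₄} : Finset V) := by
    intro d hd hda hm
    simp only [mem_insert, mem_singleton] at hm
    rcases hm with hm | hm | hm | hm
    · exact nl d x₁ hd hx hm
    · exact hda (npx _ _ (hd.symm ▸ hx) (hd.trans ha1.symm) (hm.trans ha'1.symm))
    · exact f31 (adj d _ _ hd hm)
    · exact f41 (adj d _ _ hd hm)
  have o2 : ∀ d : V × Fin 3, d.1 = x₂ → d ≠ τ a → d ≠ g →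
      (τ d).1 ∉ ({x₁, x₂, x₃, x₄} : Finset V) := by
    intro d hd hda hdg hm
    simp only [mem_insert, mem_singleton] at hm
    rcases hm with hm | hm | hm | hm
    · exact hda (npx _ _ (hd.symm ▸ hx2) (hd.trans ha'1.symm) (hm.trans ta.symm))
    · exact nl d x₂ hd hx2 hm
    · exact hdg (npx _ _ (hd.symm ▸ hx2) (hd.trans hg1.symm) (hm.trans hg'1.symm))
    · exact f42 (adj d _ _ hd hm)
  have o3 : ∀ d : V × Fin 3, d.1 = x₃ → d ≠ τ g → d ≠ k →
      (τ d).1 ∉ ({x₁, x₂, x₃, x₄} : Finset V) := by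
    intro d hd hda hdg hm
    simp only [mem_insert, mem_singleton] at hm
    rcases hm with hm | hm | hm | hm
    · exact f13 (adj d _ _ hd hm)
    · exact hda (npx _ _ (hd.symm ▸ hx3) (hd.trans hg'1.symm) (hm.trans tg.symm))
    · exact nl d x₃ hd hx3 hm
    · exact hdg (npx _ _ (hd.symm ▸ hx3) (hd.trans hk1.symm) (hm.trans hk'1'.symm))
  have o4 : ∀ d : V × Fin 3, d.1 = x₄ → d ≠ τ k →
      (τ d).1 ∉ ({x₁, x₂, x₃, x₄} : Finset V) := by
    intro d hd hda hm
    simp only [mem_insert, mem_singleton] at hm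
    rcases hm with hm | hm | hm | hm
    · exact f14 (adj d _ _ hd hm)
    · exact f24 (adj d _ _ hd hm)
    · exact hda (npx _ _ (hd.symm ▸ hx4) (hd.trans hk'1'.symm) (hm.trans tk.symm))
    · exact nl d x₄ hd hx4 hm
  intro d hd
  simp only [mem_insert, mem_singleton] at hd
  rcases hd with rfl | rfl | rfl | rfl | rfl | rfl
  · exact o1 _ hb1 hab.symm
  · exact o1 _ hb21 hab2.symm
  · exact o2 _ hp1 hap.symm hgp.symm
  · exact o3 _ hk'1 hgk'.symm hkk'.symm
  · exact o4 _ hl1 hkl.symm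
  · exact o4 _ hl'1 hkl'.symm

lemma exists_isPM_of_path (h : IsCubicMap S τ) (hc : EdgeConn3 S τ) (hT : Tight S τ)
    (hS : 7 ≤ S.card)
    (IH : ∀ (S' : Finset V) τ', S'.card < S.card → IsCubicMap S' τ' → EdgeConn3 S' τ' →
      Good S' τ')
    {x₁ x₂ x₃ x₄ : V} {a b b₂ g p k k' l l' e : V × Fin 3} (hx : x₁ ∈ S) (h₁ : Star x₁ a b b₂)
    (h₂ : Star x₂ (τ a) g p) (h₃ : Star x₃ (τ g) k k') (h₄ : Star x₄ (τ k) l l')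
    {𝒪 : Set (Set (V × Fin 3))} (hF : IsFamily S τ 𝒪)
    (hPO : ∀ O ∈ 𝒪, ∀ d ∈ O, d.1 ∉ ({x₁, x₂, x₃, x₄} : Finset V)) (he : e.1 ∈ S)
    (heP : e.1 ∉ ({x₁, x₂, x₃, x₄} : Finset V))
    (hb : (τ b).1 = (τ e).1) (hbl : (τ b).1 ≠ (τ l').1 ∧ ¬ DAdj τ (τ b).1 (τ l').1)
    (hunc : ∀ O ∈ 𝒪, ∀ i, (e.1, i) ∉ O) :
    ∃ m, IsPM S τ m ∧ Matched m e ∧ (∀ O ∈ 𝒪, ∃ d ∈ O, Matched m d) ∧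
      (Matched m k ∨ Matched m l) := by
  obtain ⟨⟨hx2, hx3, hx4⟩, ⟨n12, n13, n14, n23, n24, n34⟩, out⟩ :=
    path_cut h hc hT hS hx h₁ h₂ h₃ h₄
  obtain ⟨s1, s2, s3⟩ := h₁.snd_ne
  obtain ⟨s4, s5, s6⟩ := h₂.snd_ne
  obtain ⟨s7, s8, s9⟩ := h₃.snd_ne
  obtain ⟨s10, s11, s12⟩ := h₄.snd_ne
  obtain ⟨⟨ha1, hb1, hb21⟩, ⟨hab, hab2, hbb2⟩, c1⟩ := h₁
  obtain ⟨⟨ha'1, hg1, hp1⟩, ⟨hag, hap, hgp⟩, c2⟩ := h₂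
  obtain ⟨⟨hg'1, hk1, hk'1⟩, ⟨hgk, hgk', hkk'⟩, c3⟩ := h₃
  obtain ⟨⟨hk'1', hl1, hl'1⟩, ⟨hkl, hkl', hll'⟩, c4⟩ := h₄
  have ta : τ (τ a) = a := (h a (ha1.symm ▸ hx)).2.1
  have tg : τ (τ g) = g := (h g (hg1.symm ▸ hx2)).2.1
  have tk : τ (τ k) = k := (h k (hk1.symm ▸ hx3)).2.1
  have nbp := ne_and_not_dadj_of_path h hc hT hS (a := a) (b := b₂) (c := p) (by rwa [ha1]) hab2
    (by rw [hb21, ha1]) (by rw [hp1, ha'1]) hap.symm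
  have nkl := ne_and_not_dadj_of_path h hc hT hS (a := k) (b := k') (c := l) (by rwa [hk1]) hkk'
    (by rw [hk'1, hk1]) (by rw [hl1, hk'1']) hkl.symm
  have inner : ∀ d : V × Fin 3, d.1 ∈ ({x₁, x₂, x₃, x₄} : Finset V) →
      d = a ∨ d = τ a ∨ d = g ∨ d = τ g ∨ d = k ∨ d = τ k ∨
      d ∈ ({b, b₂, p, k', l, l'} : Finset (V × Fin 3)) := by
    intro d hd
    simp only [mem_insert, mem_singleton] at hd ⊢
    rcases hd with hd | hd | hd | hd
    · rcases c1 d hd with h0 | h0 | h0 <;> simp [h0]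
    · rcases c2 d hd with h0 | h0 | h0 <;> simp [h0]
    · rcases c3 d hd with h0 | h0 | h0 <;> simp [h0]
    · rcases c4 d hd with h0 | h0 | h0 <;> simp [h0]
  have hcut : cut τ {x₁, x₂, x₃, x₄} = {b, b₂, p, k', l, l'} := by
    ext d
    rw [mem_cut]
    constructor
    · rintro ⟨hd, hd'⟩
      rcases inner d hd with rfl | rfl | rfl | rfl | rfl | rfl | h0
      · exact absurd hd' (by simp [ha'1])
      · exact absurd hd' (by simp [ta, ha1])
      · exact absurd hd' (by simp [hg'1])
      · exact absurd hd' (by simp [tg, hg1])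
      · exact absurd hd' (by simp [hk'1'])
      · exact absurd hd' (by simp [tk, hk1])
      · exact h0
    · intro hd
      refine ⟨?_, out d hd⟩
      simp only [mem_insert, mem_singleton] at hd ⊢
      rcases hd with rfl | rfl | rfl | rfl | rfl | rfl <;> simp [*]
  have inner' : ∀ d : V × Fin 3, d.1 ∈ ({x₁, x₂, x₃, x₄} : Finset V) →
      (τ d).1 ∈ ({x₁, x₂, x₃, x₄} : Finset V) →
      d = a ∨ d = τ a ∨ d = g ∨ d = τ g ∨ d = k ∨ d = τ k := by
    intro d hd hd'
    have h1 := inner d hd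
    have h2 := out d
    rcases h1 with h1 | h1 | h1 | h1 | h1 | h1 | h1
    · simp [h1]
    · simp [h1]
    · simp [h1]
    · simp [h1]
    · simp [h1]
    · simp [h1]
    · exact absurd hd' (h2 h1)
  obtain ⟨σ, t1, t2, t3, t4, t5, t6⟩ : ∃ σ : V × Fin 3 → V × Fin 3,
      σ b = l' ∧ σ l' = b ∧ σ b₂ = p ∧ σ p = b₂ ∧ σ k' = l ∧ σ l = k' :=
    exists_pairing (fun h0 => n14 (by rw [← hb1, h0, hl'1])) hbb2
      (fun h0 => n12 (by rw [← hb1, h0, hp1])) (fun h0 => n13 (by rw [← hb1, h0, hk'1]))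
      (fun h0 => n14 (by rw [← hb1, h0, hl1])) (fun h0 => n14 (by rw [← hb21, ← h0, hl'1]))
      (fun h0 => n24 (by rw [← hp1, ← h0, hl'1])) (fun h0 => n34 (by rw [← hk'1, ← h0, hl'1]))
      hll'.symm (fun h0 => n12 (by rw [← hb21, h0, hp1])) (fun h0 => n13 (by rw [← hb21, h0, hk'1]))
      (fun h0 => n14 (by rw [← hb21, h0, hl1])) (fun h0 => n23 (by rw [← hp1, h0, hk'1]))
      (fun h0 => n24 (by rw [← hp1, h0, hl1])) (fun h0 => n34 (by rw [← hk'1, h0, hl1]))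
  have hsym := fun (d d' : V × Fin 3) (hd : d.1 ∈ S) (hh : ¬ DAdj τ (τ d').1 (τ d).1) =>
    fun hh' => hh (h.dadj_symm (u := (τ d).1) (v := (τ d').1) ((h d hd).1) hh')
  obtain ⟨m', hm1, hm2, hm3, hm4⟩ := exists_isPM_of_rejoin h hc hT IH (P := {x₁, x₂, x₃, x₄})
    (σ := σ) (by
      intro v hv
      simp only [mem_insert, mem_singleton] at hv
      rcases hv with rfl | rfl | rfl | rfl <;> assumption)
    (by
      rw [← Finset.card_pair n12]
      exact Finset.card_le_card (by grind))
    (by rw [hcut]; exact Finset.card_le_six)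
    (by
      intro d hd
      rw [hcut] at hd ⊢
      simp only [mem_insert, mem_singleton] at hd ⊢
      rcases hd with rfl | rfl | rfl | rfl | rfl | rfl
      · simp only [t1, t2, or_true, true_and]
        exact fun h0 => n14 (by rw [← hb1, ← h0, hl'1])
      · simp only [t3, t4, true_or, or_true, true_and]
        exact fun h0 => n12 (by rw [← hb21, ← h0, hp1])
      · simp only [t3, t4, true_or, or_true, true_and]
        exact fun h0 => n12 (by rw [← hb21, h0, hp1])
      · simp only [t5, t6, true_or, or_true, true_and]
        exact fun h0 => n34 (by rw [← hk'1, ← h0, hl1])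
      · simp only [t5, t6, true_or, or_true, true_and]
        exact fun h0 => n34 (by rw [← hk'1, h0, hl1])
      · simp only [t1, t2, true_or, true_and]
        exact fun h0 => n14 (by rw [← hb1, h0, hl'1]))
    (by
      intro d hd
      rw [hcut] at hd
      simp only [mem_insert, mem_singleton] at hd
      rcases hd with rfl | rfl | rfl | rfl | rfl | rfl
      · rw [t1]; exact hbl
      · rw [t3]; exact nbp
      · rw [t4]; exact ⟨nbp.1.symm, hsym _ _ (hp1.symm ▸ hx2) nbp.2⟩
      · rw [t5]; exact nkl
      · rw [t6]; exact ⟨nkl.1.symm, hsym _ _ (hl1.symm ▸ hx4) nkl.2⟩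
      · rw [t2]; exact ⟨hbl.1.symm, hsym _ _ (hl'1.symm ▸ hx4) hbl.2⟩)
    hF hPO he heP (by rw [← hb]; exact out b (by simp)) hunc
  have q1 := hm3 b (by simp [hcut])
  have q2 := hm3 b₂ (by simp [hcut])
  have q3 := hm3 k' (by simp [hcut])
  rw [t1] at q1
  rw [t3] at q2
  rw [t5] at q3
  have q0 : ¬ Matched m' (τ b) := by
    intro h1
    have h2 : τ b = τ e := by
      refine Prod.ext hb ?_
      rw [Matched] at h1 hm2
      rw [← h1, ← hm2, hb]
    have h3 := h.inj (d := b) (d' := e) (hb1.symm ▸ hx) he h2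
    exact heP (by simp [← h3, hb1])
  have q0' : ¬ Matched m' (τ l') := q0 ∘ q1.2
  obtain ⟨u₁, u₂, i1, i2, i3, i4, i5⟩ : ∃ u₁ u₂ : Fin 3, (u₁ = a.2 ↔ u₂ = (τ a).2) ∧
      (u₁ = b₂.2 ↔ Matched m' (τ b₂)) ∧ (u₂ = p.2 ↔ Matched m' (τ p)) ∧ u₁ ≠ b.2 ∧ u₂ ≠ g.2 := by
    by_cases hM : Matched m' (τ b₂)
    · exact ⟨b₂.2, p.2, iff_of_false s2.symm s5.symm, iff_of_true rfl hM,
        iff_of_true rfl (q2.1 hM), s3.symm, s6.symm⟩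
    · exact ⟨a.2, (τ a).2, iff_of_true rfl rfl, iff_of_false s2 hM,
        iff_of_false s5 (hM ∘ q2.2), s1, s4⟩
  obtain ⟨u₃, u₄, j1, j2, j3, j4, j5, j6⟩ : ∃ u₃ u₄ : Fin 3, (u₃ = k.2 ↔ u₄ = (τ k).2) ∧
      (u₃ = k'.2 ↔ Matched m' (τ k')) ∧ (u₄ = l.2 ↔ Matched m' (τ l)) ∧ u₃ ≠ (τ g).2 ∧
      u₄ ≠ l'.2 ∧ (u₃ = k.2 ∨ u₄ = l.2) := by
    by_cases hM : Matched m' (τ k')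
    · exact ⟨k'.2, l.2, iff_of_false s9.symm s10.symm, iff_of_true rfl hM,
        iff_of_true rfl (q3.1 hM), s8.symm, s12, .inr rfl⟩
    · exact ⟨k.2, (τ k).2, iff_of_true rfl rfl, iff_of_false s9 hM,
        iff_of_false s10 (hM ∘ q3.2), s7.symm, s11, .inl rfl⟩
  obtain ⟨f, f1, f2, f3, f4⟩ : ∃ f : V → Fin 3, f x₁ = u₁ ∧ f x₂ = u₂ ∧ f x₃ = u₃ ∧ f x₄ = u₄ :=
    ⟨fun v => if v = x₁ then u₁ else if v = x₂ then u₂ else if v = x₃ then u₃ else u₄, by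
      simp [n12.symm, n13.symm, n23.symm, n14.symm, n24.symm, n34.symm]⟩
  obtain ⟨m, hm, hmP, hme, hmO⟩ := hm4 f
    (by
      intro d hd hd' hdm
      rcases inner' d hd hd' with rfl | rfl | rfl | rfl | rfl | rfl <;> rw [Matched] at hdm ⊢
      · rw [ha1, f1] at hdm
        rw [ha'1, f2]
        exact i1.1 hdm
      · rw [ha'1, f2] at hdm
        rw [ta, ha1, f1]
        exact i1.2 hdm
      · rw [hg1, f2] at hdm
        exact absurd hdm i5
      · rw [hg'1, f3] at hdm
        exact absurd hdm j4
      · rw [hk1, f3] at hdm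
        rw [hk'1', f4]
        exact j1.1 hdm
      · rw [hk'1', f4] at hdm
        rw [tk, hk1, f3]
        exact j1.2 hdm)
    (by
      intro d hd
      rw [hcut] at hd
      simp only [mem_insert, mem_singleton] at hd
      rcases hd with rfl | rfl | rfl | rfl | rfl | rfl
      · exact iff_of_false (by rwa [Matched, hb1, f1]) q0
      · rwa [Matched, hb21, f1]
      · rwa [Matched, hp1, f2]
      · rwa [Matched, hk'1, f3]
      · rwa [Matched, hl1, f4]
      · exact iff_of_false (by rwa [Matched, hl'1, f4]) q0')
  refine ⟨m, hm, hme, hmO, ?_⟩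
  rw [Matched, Matched, hk1, hl1, hmP x₃ (by simp), hmP x₄ (by simp), f3, f4]
  exact j6

/-- The dart set `O` has a dart at `v`. -/
def Covers (O : Set (V × Fin 3)) (v : V) : Prop := ∃ d ∈ O, d.1 = v

lemma Star.swap {x : V} {a b c : V × Fin 3} (h : Star x a b c) : Star x b a c :=
  Star.of_ne h.1.2.1 h.1.1 h.1.2.2 h.2.1.1.symm h.2.1.2.2 h.2.1.2.1

lemma Star.swap_right {x : V} {a b c : V × Fin 3} (h : Star x a b c) : Star x a c b :=
  Star.of_ne h.1.1 h.1.2.2 h.1.2.1 h.2.1.2.1 h.2.1.1 h.2.1.2.2.symm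

lemma Matched.eq {m : V → Fin 3} {d d' : V × Fin 3} (h : Matched m d) (h' : Matched m d')
    (hd : d.1 = d'.1) : d = d' :=
  Prod.ext hd (h.symm.trans ((congrArg m hd).trans h'))

lemma IsObj.exists_star {O : Set (V × Fin 3)} (hO : IsObj S τ O) {d : V × Fin 3} (hd : d ∈ O) :
    ∃ b c, Star d.1 d b c ∧ b ∈ O ∧ c ∉ O := by
  obtain ⟨v, i⟩ := d
  rcases hO.2.2.2 v with h | ⟨k, hk⟩
  · exact absurd hd (h i)
  · have : ∀ i k : Fin 3, ∃ j, j ≠ i ∧ j ≠ k := by decide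
    obtain ⟨j, hji, hjk⟩ := this i k
    have hik := (hk i).1 hd
    exact ⟨(v, j), (v, k), Star.of_ne rfl rfl rfl (by simpa using hji.symm) (by simpa using hik)
      (by simpa using hjk), (hk j).2 hjk, fun h => (hk k).1 h rfl⟩

lemma IsObj.eq_of_notMem {O : Set (V × Fin 3)} (hO : IsObj S τ O) {v : V} (hv : Covers O v)
    {d d' : V × Fin 3} (hd : d ∉ O) (hd' : d' ∉ O) (h : d.1 = v) (h' : d'.1 = v) : d = d' := by
  obtain ⟨f, hf, rfl⟩ := hv
  rcases hO.2.2.2 f.1 with h0 | ⟨k, hk⟩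
  · exact absurd hf (h0 _)
  · have h1 := (hk d.2).not.1 (by rwa [← h])
    have h2 := (hk d'.2).not.1 (by rwa [← h'])
    exact Prod.ext (h.trans h'.symm) (by simp_all)

lemma IsObj.matched_of_missed {O : Set (V × Fin 3)} (hO : IsObj S τ O) {m : V → Fin 3}
    (hmiss : ∀ d ∈ O, ¬ Matched m d) {d : V × Fin 3} (hd : d ∉ O) (hcov : Covers O d.1) :
    Matched m d := by
  have h1 : (d.1, m d.1) ∉ O := fun h => hmiss _ h rfl
  exact congrArg Prod.snd (hO.eq_of_notMem hcov h1 hd rfl rfl)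

lemma IsObj.matched_of_uncovered (h : IsCubicMap S τ) {O : Set (V × Fin 3)} (hO : IsObj S τ O)
    {m : V → Fin 3} (hm : IsPM S τ m) (hmiss : ∀ d ∈ O, ¬ Matched m d) {d : V × Fin 3}
    (hdS : d.1 ∈ S) (hd : ¬ Covers O d.1) (hcov : Covers O (τ d).1) : Matched m d := by
  have h1 := h d hdS
  have h2 : τ d ∉ O := fun h3 => hd ⟨d, by rw [← h1.2.1]; exact hO.2.2.1 _ h3, rfl⟩
  have h3 := hm (τ d) h1.1 (hO.matched_of_missed hmiss h2 hcov)
  rwa [h1.2.1] at h3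

lemma IsFamily.eq_of_covers {𝒪 : Set (Set (V × Fin 3))} (hF : IsFamily S τ 𝒪)
    {O O' : Set (V × Fin 3)} (hO : O ∈ 𝒪) (hO' : O' ∈ 𝒪) {v : V} (hv : Covers O v)
    (hv' : Covers O' v) : O = O' := by
  obtain ⟨⟨x, i⟩, hd, rfl⟩ := hv
  obtain ⟨⟨y, j⟩, hd', h⟩ := hv'
  obtain rfl : y = x := h
  exact hF.eq_of_mem hO hO' hd hd'

lemma good_of_tight (h : IsCubicMap S τ) (hc : EdgeConn3 S τ) (hT : Tight S τ)
    (hS : 7 ≤ S.card)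
    (IH : ∀ (S' : Finset V) τ', S'.card < S.card → IsCubicMap S' τ' → EdgeConn3 S' τ' →
      Good S' τ') : Good S τ := by
  intro 𝒪 hF e he hunc
  have hE := h e he
  set 𝒪₀ : Set (Set (V × Fin 3)) :=
    {O ∈ 𝒪 | ∃ m, IsPM S τ m ∧ Matched m e ∧ ∀ d ∈ O, ¬ Matched m d} with h𝒪₀
  have hF₀ : IsFamily S τ 𝒪₀ := hF.mono fun O hO => hO.1
  have hunc₀ : ∀ O ∈ 𝒪₀, ∀ i, (e.1, i) ∉ O := fun O hO => hunc O hO.1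
  have hz : ∀ O ∈ 𝒪₀, ¬ Covers O e.1 := by
    rintro O hO ⟨⟨v, i⟩, hd, rfl⟩
    exact hunc₀ O hO i hd
  suffices hsuff : ∃ m, IsPM S τ m ∧ Matched m e ∧ ∀ O ∈ 𝒪₀, ∃ d ∈ O, Matched m d by
    obtain ⟨m, hm, hme, hmO⟩ := hsuff
    refine ⟨m, hm, hme, fun O hO => ?_⟩
    by_contra hno
    push Not at hno
    obtain ⟨d, hd, hdm⟩ := hmO O ⟨hO, m, hm, hme, hno⟩
    exact hno d hd hdm
  have f1 : ∀ O ∈ 𝒪₀, ∀ d d' : V × Fin 3, d.1 ∈ S → d.1 = d'.1 → ¬ Covers O d.1 →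
      Covers O (τ d).1 → Covers O (τ d').1 → d = d' := by
    rintro O ⟨hO, m, hm, -, hmiss⟩ d d' hdS hdd hd hcd hcd'
    exact ((hF.1 O hO).matched_of_uncovered h hm hmiss hdS hd hcd).eq
      ((hF.1 O hO).matched_of_uncovered h hm hmiss (hdd ▸ hdS) (hdd ▸ hd) hcd') hdd
  have f2 : ∀ O ∈ 𝒪₀, ∀ d : V × Fin 3, d.1 = e.1 → Covers O (τ d).1 → d = e := by
    rintro O ⟨hO, m, hm, hme, hmiss⟩ d hde hcd
    exact ((hF.1 O hO).matched_of_uncovered h hm hmiss (hde ▸ he)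
      (hde ▸ hz O ⟨hO, m, hm, hme, hmiss⟩) hcd).eq hme hde
  have f3 : ∀ O ∈ 𝒪₀, ¬ Covers O (τ e).1 → ∀ d : V × Fin 3, d.1 = (τ e).1 →
      ¬ Covers O (τ d).1 := by
    rintro O ⟨hO, m, hm, hme, hmiss⟩ hw d hde hcd
    have h1 := ((hF.1 O hO).matched_of_uncovered h hm hmiss (hde ▸ hE.1)
      (hde ▸ hw) hcd).eq (hm e he hme) hde
    rw [h1, hE.2.1] at hcd
    exact hz O ⟨hO, m, hm, hme, hmiss⟩ hcd
  have removing : ∀ O₁ ∈ 𝒪₀, ∀ O ∈ 𝒪₀ \ {O₁}, ∀ d ∈ O, ¬ Covers O₁ d.1 := by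
    intro O₁ hO₁ O hO d hd hcov
    exact hO.2 (hF₀.eq_of_covers hO.1 hO₁ ⟨d, hd, rfl⟩ hcov)
  have restore : ∀ O₁ ∈ 𝒪₀, (∃ m, IsPM S τ m ∧ Matched m e ∧
      (∀ O ∈ 𝒪₀ \ {O₁}, ∃ d ∈ O, Matched m d) ∧ ∃ d ∈ O₁, Matched m d) →
      ∃ m, IsPM S τ m ∧ Matched m e ∧ ∀ O ∈ 𝒪₀, ∃ d ∈ O, Matched m d := by
    rintro O₁ - ⟨m, hm, hme, hmO, hm1⟩
    refine ⟨m, hm, hme, fun O hO => ?_⟩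
    by_cases hOO : O = O₁
    · rwa [hOO]
    · exact hmO O ⟨hO, hOO⟩
  by_cases hw : ∃ O ∈ 𝒪₀, Covers O (τ e).1
  · obtain ⟨O, hO, w, hwO, hw1⟩ := hw
    have hobj := hF₀.1 O hO
    have hwS := hobj.2.1 w hwO
    have hW := h w hwS
    have hbO := hobj.2.2.1 w hwO
    obtain ⟨a, c, hs1, haO, -⟩ := hobj.exists_star hbO
    have haO' := hobj.2.2.1 a haO
    obtain ⟨c', b', hs2, hcO', -⟩ := hobj.exists_star haO'
    have hxc : Covers O (τ w).1 := ⟨τ w, hbO, rfl⟩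
    have hyc : Covers O (τ a).1 := ⟨τ a, haO', rfl⟩
    obtain ⟨m, hm, hme, hmO, hma⟩ := exists_isPM_of_edge h hc hT hS IH hW.1 hs1.swap
      hs2.swap_right (hF₀.mono (𝒪' := 𝒪₀ \ {O}) Set.sdiff_subset)
      (fun O' hO' d hd => ⟨fun h0 => removing O hO O' hO' d hd (h0 ▸ hxc),
        fun h0 => removing O hO O' hO' d hd (h0 ▸ hyc)⟩) he
      (fun h0 => hz O hO (h0 ▸ hxc)) (fun h0 => hz O hO (h0 ▸ hyc))
      (by rw [hW.2.1, hw1]) (fun O' hO' => hunc₀ O' hO'.1)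
    refine restore O hO ⟨m, hm, hme, hmO, ?_⟩
    rcases hma with hma | hma
    · exact ⟨c', hcO', hma⟩
    · exact ⟨a, haO, hma⟩
  push Not at hw
  obtain ⟨b₁, s₁, hsw⟩ := exists_star (τ e)
  obtain ⟨⟨-, hb₁, hs₁⟩, ⟨hb₁e, hs₁e, hbs⟩, hw3⟩ := hsw
  have hB := h b₁ (hb₁ ▸ hE.1)
  have hSS := h s₁ (hs₁ ▸ hE.1)
  have hr : ∀ O ∈ 𝒪₀, ¬ Covers O (τ b₁).1 := fun O hO => f3 O hO (hw O hO) b₁ hb₁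
  have hs : ∀ O ∈ 𝒪₀, ¬ Covers O (τ s₁).1 := fun O hO => f3 O hO (hw O hO) s₁ hs₁
  have hzr : e.1 ≠ (τ b₁).1 := fun h0 => hb₁e.symm
    (no_parallel h hc (by omega) (d := b₁) (hb₁ ▸ hE.1) hb₁ (by rw [← h0, hE.2.1]))
  obtain ⟨a, b₂, hsr⟩ := exists_star (τ b₁)
  have haS : a.1 ∈ S := hsr.1.2.1 ▸ hB.1
  have hA := h a haS
  have e1 : DAdj τ e.1 (τ e).1 := dadj_of_dart
  have e2 : DAdj τ (τ e).1 (τ b₁).1 := hb₁ ▸ dadj_of_dart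
  have e3 : DAdj τ (τ b₁).1 (τ a).1 := hsr.1.2.1 ▸ dadj_of_dart
  have hzr1 : e.1 ≠ (τ a).1 := fun h0 =>
    no_triangle h hc hT (by omega) he e1 e2 (h0.symm ▸ e3)
  have hbw : (τ (τ b₁)).1 = (τ e).1 := by rw [hB.2.1, hb₁]
  by_cases hr1 : ∃ O ∈ 𝒪₀, Covers O (τ a).1
  swap
  · push Not at hr1
    obtain ⟨b', c', hs2⟩ := exists_star (τ a)
    obtain ⟨m, hm, hme, hmO, -⟩ := exists_isPM_of_edge h hc hT hS IH hB.1 hsr.swap hs2 hF₀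
      (fun O hO d hd => ⟨fun h0 => hr O hO ⟨d, hd, h0⟩, fun h0 => hr1 O hO ⟨d, hd, h0⟩⟩) he
      hzr hzr1 hbw hunc₀
    exact ⟨m, hm, hme, hmO⟩
  obtain ⟨O₁, hO₁, g, hg, hg1⟩ := hr1
  have hobj := hF₀.1 O₁ hO₁
  have haO : τ a ∉ O₁ := fun h0 => hr O₁ hO₁
    ⟨a, by rw [← hA.2.1]; exact hobj.2.2.1 _ h0, hsr.1.2.1⟩
  obtain ⟨p, a', hsg, hp, ha'⟩ := hobj.exists_star hg
  have hr1c : Covers O₁ (τ a).1 := ⟨g, hg, hg1⟩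
  obtain rfl : a' = τ a := hobj.eq_of_notMem hr1c ha' haO (by rw [hsg.1.2.2, hg1]) rfl
  rw [hg1] at hsg
  have hsr1 : Star (τ a).1 (τ a) g p := hsg.swap_right.swap
  have continue_path : ∀ g ∈ O₁, ∃ k k' l l', Star (τ g).1 (τ g) k k' ∧ Star (τ k).1 (τ k) l l' ∧
      k ∈ O₁ ∧ l ∈ O₁ ∧ l' ∉ O₁ := by
    intro g hg
    obtain ⟨k, k', hs3, hk, -⟩ := hobj.exists_star (hobj.2.2.1 g hg)
    obtain ⟨l, l', hs4, hl, hl'⟩ := hobj.exists_star (hobj.2.2.1 k hk)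
    exact ⟨k, k', l, l', hs3, hs4, hk, hl, hl'⟩
  have finish : ∀ g p k k' l l', g ∈ O₁ → Star (τ a).1 (τ a) g p → Star (τ g).1 (τ g) k k' →
      Star (τ k).1 (τ k) l l' → k ∈ O₁ → l ∈ O₁ → (τ l').1 ≠ (τ s₁).1 →
      ∃ m, IsPM S τ m ∧ Matched m e ∧ ∀ O ∈ 𝒪₀, ∃ d ∈ O, Matched m d := by
    intro g p k k' l l' hg hs2 hs3 hs4 hk hl hne
    obtain ⟨⟨hx2, hx3, hx4⟩, ⟨-, -, -, -, n24, -⟩, -⟩ :=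
      path_cut h hc hT hS hB.1 hsr.swap hs2 hs3 hs4
    have hl'1 : l'.1 = (τ k).1 := hs4.1.2.2
    have hL := h l' (hl'1 ▸ hx4)
    have hc1 : Covers O₁ (τ g).1 := ⟨τ g, hobj.2.2.1 g hg, rfl⟩
    have hc2 : Covers O₁ (τ k).1 := ⟨τ k, hobj.2.2.1 k hk, rfl⟩
    have hc2' : Covers O₁ (τ (τ l')).1 := by rwa [hL.2.1, hl'1]
    obtain ⟨m, hm, hme, hmO, hmk⟩ := exists_isPM_of_path h hc hT hS IH hB.1 hsr.swap hs2 hs3 hs4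
      (hF₀.mono (𝒪' := 𝒪₀ \ {O₁}) Set.sdiff_subset)
      (by
        intro O hO d hd hdP
        have h1 := removing O₁ hO₁ O hO d hd
        simp only [mem_insert, mem_singleton] at hdP
        rcases hdP with h0 | h0 | h0 | h0
        · exact hr O hO.1 ⟨d, hd, h0⟩
        · exact h1 (h0 ▸ hr1c)
        · exact h1 (h0 ▸ hc1)
        · exact h1 (h0 ▸ hc2)) he
      (by
        intro hdP
        simp only [mem_insert, mem_singleton] at hdP
        rcases hdP with h0 | h0 | h0 | h0
        · exact hzr h0
        · exact hzr1 h0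
        · exact hz O₁ hO₁ (h0 ▸ hc1)
        · exact hz O₁ hO₁ (h0 ▸ hc2)) hbw
      (by
        rw [hbw]
        constructor
        · intro h0
          exact f3 O₁ hO₁ (hw O₁ hO₁) (τ l') h0.symm hc2'
        · rintro ⟨i, hi⟩
          rcases hw3 ((τ e).1, i) rfl with h0 | h0 | h0 <;> rw [h0] at hi
          · rw [hE.2.1] at hi
            have h2 := f2 O₁ hO₁ (τ l') hi.symm hc2'
            rw [h2] at hc2'
            exact hw O₁ hO₁ hc2'
          · have h2 := f1 O₁ hO₁ (τ l') a hL.1 (by rw [← hi, hsr.1.2.1])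
              (by rw [← hi]; exact hr O₁ hO₁) hc2' hr1c
            apply n24
            rw [← h2, hL.2.1, hl'1]
          · exact hne hi.symm)
      (fun O hO => hunc₀ O hO.1)
    refine restore O₁ hO₁ ⟨m, hm, hme, hmO, ?_⟩
    rcases hmk with hmk | hmk
    · exact ⟨k, hk, hmk⟩
    · exact ⟨l, hl, hmk⟩
  obtain ⟨k, k', l, l', hs3, hs4, hk, hl, hl'⟩ := continue_path g hg
  by_cases hne : (τ l').1 = (τ s₁).1
  swap
  · exact finish g p k k' l l' hg hsr1 hs3 hs4 hk hl hne
  obtain ⟨q, q', n, n', hs5, hs6, hq, hn, hn'⟩ := continue_path p hp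
  refine finish p g q q' n n' hp hsr1.swap_right hs5 hs6 hq hn fun hne' => ?_
  obtain ⟨⟨hx2, hx3, hx4⟩, ⟨-, -, -, -, n24, -⟩, -⟩ :=
    path_cut h hc hT hS hB.1 hsr.swap hsr1 hs3 hs4
  obtain ⟨⟨-, hy3, hy4⟩, -⟩ := path_cut h hc hT hS hB.1 hsr.swap hsr1.swap_right hs5 hs6
  have hL := h l' (hs4.1.2.2 ▸ hx4)
  have hN := h n' (hs6.1.2.2 ▸ hy4)
  have h1 := f1 O₁ hO₁ (τ l') (τ n') hL.1 (hne.trans hne'.symm) (by rw [hne]; exact hs O₁ hO₁)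
    ⟨τ k, hobj.2.2.1 k hk, by rw [hL.2.1, hs4.1.2.2]⟩
    ⟨τ q, hobj.2.2.1 q hq, by rw [hN.2.1, hs6.1.2.2]⟩
  have h2 := h.inj (hs4.1.2.2 ▸ hx4) (hs6.1.2.2 ▸ hy4) h1
  have h3 : (τ k).1 = (τ q).1 := by rw [← hs4.1.2.2, h2, hs6.1.2.2]
  have d1 : DAdj τ (τ a).1 (τ g).1 := hsr1.1.2.1 ▸ dadj_of_dart
  have d2 : DAdj τ (τ g).1 (τ k).1 := hs3.1.2.1 ▸ dadj_of_dart
  have d3 : DAdj τ (τ p).1 (τ q).1 := hs5.1.2.1 ▸ dadj_of_dart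
  have d4 : DAdj τ (τ a).1 (τ p).1 := hsr1.1.2.2 ▸ dadj_of_dart
  refine no_square h hc hT hS hx2 d1 d2 (h3 ▸ h.dadj_symm hy3 d3) (h.dadj_symm hx2 d4) n24 ?_
  intro h0
  exact hsr1.2.1.2.2 (no_parallel h hc (by omega) (hsr1.1.2.1 ▸ hx2)
    (by rw [hsr1.1.2.1, hsr1.1.2.2]) h0)

lemma exists_isPM_of_edges {E : Set (V × Fin 3)} (h1 : ∀ v ∈ S, ∃ d ∈ E, d.1 = v)
    (h2 : ∀ d ∈ E, ∀ d' ∈ E, d.1 = d'.1 → d = d') (h3 : ∀ d ∈ E, τ d ∈ E) :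
    ∃ m, IsPM S τ m ∧ ∀ d ∈ E, Matched m d := by
  have h4 : ∀ v, ∃ i, ∀ d ∈ E, d.1 = v → i = d.2 := by
    intro v
    by_cases h : ∃ d ∈ E, d.1 = v
    · obtain ⟨d, hd, rfl⟩ := h
      exact ⟨d.2, fun d' hd' hdd => by rw [h2 d hd d' hd' hdd.symm]⟩
    · push Not at h
      exact ⟨0, fun d hd hdv => absurd hdv (h d hd)⟩
  choose m hm using h4
  have hmE : ∀ d ∈ E, Matched m d := fun d hd => hm _ d hd rfl
  refine ⟨m, fun d hd hdm => ?_, hmE⟩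
  obtain ⟨d', hd', hdd⟩ := h1 d.1 hd
  obtain rfl := (hmE d' hd').eq hdm hdd
  exact hmE _ (h3 _ hd')

lemma even_card (h : IsCubicMap S τ) : Even S.card := by
  have h1 := even_card_cut_add h (Finset.Subset.refl S)
  have h2 : cut τ S = ∅ := by
    ext d
    have := h d
    grind [mem_cut]
  simpa [h2] using h1

lemma exists_dart_to (h : IsCubicMap S τ) (hc : EdgeConn3 S τ) (hS : 3 ≤ S.card) {x z r s : V}
    (hx : x ∈ S) (hxy : ∀ d : V × Fin 3, d.1 = x → (τ d).1 = z ∨ (τ d).1 = r ∨ (τ d).1 = s) :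
    (∃ f, f.1 = x ∧ (τ f).1 = r) ∧ ∃ f, f.1 = x ∧ (τ f).1 = s := by
  obtain ⟨b, c, ⟨⟨-, h1, h2⟩, ⟨h3, h4, h5⟩, -⟩⟩ := exists_star (x, (0 : Fin 3))
  have npx : ∀ d d' : V × Fin 3, d.1 = x → d'.1 = x → (τ d).1 = (τ d').1 → d = d' :=
    fun d d' hd hd' => no_parallel h hc (by omega) (hd ▸ hx) (hd.trans hd'.symm)
  have k1 := hxy (x, 0) rfl
  have k2 := hxy b h1
  have k3 := hxy c h2
  have n1 := npx (x, 0) b rfl h1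
  have n2 := npx (x, 0) c rfl h2
  have n3 := npx b c h1 h2
  constructor
  · by_contra! hno
    have := hno (x, 0) rfl
    have := hno b h1
    have := hno c h2
    grind
  · by_contra! hno
    have := hno (x, 0) rfl
    have := hno b h1
    have := hno c h2
    grind

lemma IsObj.false_of_covers_only (h : IsCubicMap S τ) (hc : EdgeConn3 S τ) (hS : 2 ≤ S.card)
    {O : Set (V × Fin 3)} (hO : IsObj S τ O) {w : V} (hw : ∀ v ∈ S, Covers O v → v = w) :
    False := by
  obtain ⟨d, hd⟩ := hO.1
  have h1 := hw _ (hO.2.1 d hd) ⟨d, hd, rfl⟩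
  have h2 := hO.2.2.1 d hd
  have h3 := hw _ (hO.2.1 _ h2) ⟨_, h2, rfl⟩
  exact no_loop h hc hS (hO.2.1 d hd) (h3.trans h1.symm)

lemma good_of_card_le_six (h : IsCubicMap S τ) (hc : EdgeConn3 S τ) (hT : Tight S τ)
    (hS : S.card ≤ 6) : Good S τ := by
  intro 𝒪 hF e he hunc
  have hE := h e he
  have hz : ∀ O ∈ 𝒪, ¬ Covers O e.1 := by
    rintro O hO ⟨⟨v, i⟩, hd, rfl⟩
    exact hunc O hO i hd
  obtain ⟨n, hn⟩ := even_card h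
  have hpos := Finset.card_pos.2 ⟨_, he⟩
  have hS2 : 2 ≤ S.card := by omega
  have hzw : e.1 ≠ (τ e).1 := (no_loop h hc hS2 he).symm
  obtain ⟨d₁, d₂, hsz⟩ := exists_star e
  obtain ⟨⟨-, hd₁, hd₂⟩, ⟨hed₁, hed₂, hdd⟩, -⟩ := hsz
  have hD1 := h d₁ (hd₁ ▸ he)
  have hD2 := h d₂ (hd₂ ▸ he)
  have nbrs : ∀ m, IsPM S τ m → Matched m e → ∀ O ∈ 𝒪, (∀ d ∈ O, ¬ Matched m d) →
      ¬ Covers O (τ d₁).1 ∧ ¬ Covers O (τ d₂).1 := by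
    intro m hm hme O hO hmiss
    refine ⟨fun h0 => hed₁ ?_, fun h0 => hed₂ ?_⟩
    · exact (((hF.1 O hO).matched_of_uncovered h hm hmiss (hd₁ ▸ he) (hd₁ ▸ hz O hO) h0).eq hme
        hd₁).symm
    · exact (((hF.1 O hO).matched_of_uncovered h hm hmiss (hd₂ ▸ he) (hd₂ ▸ hz O hO) h0).eq hme
        hd₂).symm
  obtain h2 | h4 | h6 : S.card = 2 ∨ S.card = 4 ∨ S.card = 6 := by omega
  · have hSe : S = {e.1, (τ e).1} := by
      refine (Finset.eq_of_subset_of_card_le (by grind) ?_).symm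
      rw [Finset.card_pair hzw, h2]
    obtain ⟨m, hm, hmE⟩ := exists_isPM_of_edges (S := S) (τ := τ) (E := {e, τ e})
      (by rw [hSe]; simp) (by grind) (by simp [hE.2.1])
    refine ⟨m, hm, hmE e (by simp), fun O hO => ?_⟩
    exfalso
    refine (hF.1 O hO).false_of_covers_only h hc hS2 (w := (τ e).1) fun v hv hcov => ?_
    have := hz O hO
    grind
  all_goals
    have npx : ∀ d d' : V × Fin 3, d.1 ∈ S → d.1 = d'.1 → (τ d).1 = (τ d').1 → d = d' :=
      fun d d' => no_parallel h hc (by omega)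
    have nl : ∀ d : V × Fin 3, d.1 ∈ S → (τ d).1 ≠ d.1 := fun d => no_loop h hc (by omega)
    have nwp : (τ e).1 ≠ (τ d₁).1 := fun h0 => hed₁ (npx _ _ he hd₁.symm h0)
    have nwq : (τ e).1 ≠ (τ d₂).1 := fun h0 => hed₂ (npx _ _ he hd₂.symm h0)
    have npq : (τ d₁).1 ≠ (τ d₂).1 := fun h0 =>
      hdd (npx _ _ (hd₁ ▸ he) (hd₁.trans hd₂.symm) h0)
    have nzp : e.1 ≠ (τ d₁).1 := hd₁ ▸ (nl d₁ (hd₁ ▸ he)).symm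
    have nzq : e.1 ≠ (τ d₂).1 := hd₂ ▸ (nl d₂ (hd₂ ▸ he)).symm
  · have hSe : S = {e.1, (τ e).1, (τ d₁).1, (τ d₂).1} := by
      refine (Finset.eq_of_subset_of_card_le ?_ ?_).symm
      · grind
      · rw [Finset.card_eq_four.2 ⟨_, _, _, _, hzw, nzp, nzq, nwp, nwq, npq, rfl⟩, h4]
    obtain ⟨-, f, hf, hf'⟩ := exists_dart_to (z := e.1) (r := (τ e).1) (s := (τ d₂).1)
      h hc (by omega) hD1.1 (by
        intro d hd
        have h1 := (h d (hd ▸ hD1.1)).1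
        have h2 := nl d (hd ▸ hD1.1)
        rw [hSe] at h1
        grind)
    have hFF := h f (hf ▸ hD1.1)
    obtain ⟨m, hm, hmE⟩ := exists_isPM_of_edges (S := S) (τ := τ) (E := {e, τ e, f, τ f})
      (by rw [hSe]; simp [hf, hf']) (by grind) (by simp [hE.2.1, hFF.2.1])
    refine ⟨m, hm, hmE e (by simp), fun O hO => ?_⟩
    by_contra! hno
    obtain ⟨k1, k2⟩ := nbrs m hm (hmE e (by simp)) O hO hno
    refine (hF.1 O hO).false_of_covers_only h hc hS2 (w := (τ e).1) fun v hv hcov => ?_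
    have := hz O hO
    grind
  · obtain ⟨b₁, b₂, hsw⟩ := exists_star (τ e)
    obtain ⟨⟨-, hb₁, hb₂⟩, ⟨heb₁, heb₂, hbb⟩, -⟩ := hsw
    have hB1 := h b₁ (hb₁ ▸ hE.1)
    have hB2 := h b₂ (hb₂ ▸ hE.1)
    have tri : ∀ a b c, a ∈ S → DAdj τ a b → DAdj τ b c → DAdj τ c a → False :=
      fun a b c => no_triangle h hc hT (by omega)
    have ezw : DAdj τ e.1 (τ e).1 := dadj_of_dart
    have ezp : DAdj τ e.1 (τ d₁).1 := hd₁ ▸ dadj_of_dart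
    have ezq : DAdj τ e.1 (τ d₂).1 := hd₂ ▸ dadj_of_dart
    have ewr : DAdj τ (τ e).1 (τ b₁).1 := hb₁ ▸ dadj_of_dart
    have ews : DAdj τ (τ e).1 (τ b₂).1 := hb₂ ▸ dadj_of_dart
    have epz := h.dadj_symm he ezp
    have eqz := h.dadj_symm he ezq
    have ewz := h.dadj_symm he ezw
    have nrs : (τ b₁).1 ≠ (τ b₂).1 := fun h0 =>
      hbb (npx _ _ (hb₁ ▸ hE.1) (hb₁.trans hb₂.symm) h0)
    have nwr : (τ e).1 ≠ (τ b₁).1 := hb₁ ▸ (nl b₁ (hb₁ ▸ hE.1)).symm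
    have nws : (τ e).1 ≠ (τ b₂).1 := hb₂ ▸ (nl b₂ (hb₂ ▸ hE.1)).symm
    have nzr : e.1 ≠ (τ b₁).1 := fun h0 =>
      heb₁ (npx _ _ hE.1 hb₁.symm (by rw [hE.2.1, h0]))
    have nzs : e.1 ≠ (τ b₂).1 := fun h0 =>
      heb₂ (npx _ _ hE.1 hb₂.symm (by rw [hE.2.1, h0]))
    have npr : (τ d₁).1 ≠ (τ b₁).1 := fun h0 => tri _ _ _ he ezw ewr (h0 ▸ epz)
    have nps : (τ d₁).1 ≠ (τ b₂).1 := fun h0 => tri _ _ _ he ezw ews (h0 ▸ epz)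
    have nqr : (τ d₂).1 ≠ (τ b₁).1 := fun h0 => tri _ _ _ he ezw ewr (h0 ▸ eqz)
    have nqs : (τ d₂).1 ≠ (τ b₂).1 := fun h0 => tri _ _ _ he ezw ews (h0 ▸ eqz)
    have hSe : S = {e.1, (τ e).1, (τ d₁).1, (τ d₂).1, (τ b₁).1, (τ b₂).1} := by
      refine (Finset.eq_of_subset_of_card_le ?_ ?_).symm
      · grind
      · rw [h6]
        simp [hzw, nzp, nzq, nzr, nzs, nwp, nwq, nwr, nws, npq, npr, nps, nqr, nqs, nrs]
    have mem : ∀ v ∈ S, v = e.1 ∨ v = (τ e).1 ∨ v = (τ d₁).1 ∨ v = (τ d₂).1 ∨ v = (τ b₁).1 ∨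
        v = (τ b₂).1 := by
      intro v hv
      rw [hSe] at hv
      simpa using hv
    have reach : ∀ x ∈ S, DAdj τ x e.1 → x = (τ d₁).1 ∨ x = (τ d₂).1 →
        (∃ f, f.1 = x ∧ (τ f).1 = (τ b₁).1) ∧ ∃ f, f.1 = x ∧ (τ f).1 = (τ b₂).1 := by
      intro x hx hxz hxpq
      refine exists_dart_to h hc (by omega) (z := e.1) hx fun d hd => ?_
      have hds := h d (hd ▸ hx)
      have hxy : DAdj τ x (τ d).1 := hd ▸ dadj_of_dart
      rcases mem _ hds.1 with h0 | h0 | h0 | h0 | h0 | h0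
      · exact .inl h0
      · exact (tri _ _ _ hx hxy (h0 ▸ ewz) (h.dadj_symm hx hxz)).elim
      · rcases hxpq with h1 | h1
        · exact absurd (h0.trans (h1.symm.trans hd.symm)) (nl d (hd ▸ hx))
        · exact (tri _ _ _ hx hxy (h0 ▸ epz) (h.dadj_symm hx hxz)).elim
      · rcases hxpq with h1 | h1
        · exact (tri _ _ _ hx hxy (h0 ▸ eqz) (h.dadj_symm hx hxz)).elim
        · exact absurd (h0.trans (h1.symm.trans hd.symm)) (nl d (hd ▸ hx))
      · exact .inr (.inl h0)
      · exact .inr (.inr h0)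
    obtain ⟨⟨f, hf, hfr⟩, f', hf', hfs⟩ := reach _ hD1.1 epz (.inl rfl)
    obtain ⟨⟨g', hg', hgr⟩, g, hg, hgs⟩ := reach _ hD2.1 eqz (.inr rfl)
    have hFF := h f (hf ▸ hD1.1)
    have hFF' := h f' (hf' ▸ hD1.1)
    have hGG := h g (hg ▸ hD2.1)
    have hGG' := h g' (hg' ▸ hD2.1)
    have hnd : ([e, τ e, f, τ f, g, τ g].map Prod.fst).Nodup := by
      simp [hf, hfr, hg, hgs, hzw, nzp, nzq, nzr, nzs, nwp, nwq, nwr, nws, npq, npr, nps, nqs, nrs,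
        nqr.symm]
    obtain ⟨m, hm, hmE⟩ := exists_isPM_of_edges (S := S) (τ := τ) (E := {e, τ e, f, τ f, g, τ g})
      (by
        intro v hv
        rcases mem v hv with rfl | rfl | rfl | rfl | rfl | rfl
        · exact ⟨e, by simp, rfl⟩
        · exact ⟨τ e, by simp, rfl⟩
        · exact ⟨f, by simp, hf⟩
        · exact ⟨g, by simp, hg⟩
        · exact ⟨τ f, by simp, hfr⟩
        · exact ⟨τ g, by simp, hgs⟩)
      (fun d hd d' hd' hdd => List.inj_on_of_nodup_map hnd (by simpa using hd) (by simpa using hd')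
        hdd)
      (by simp [hE.2.1, hFF.2.1, hGG.2.1])
    refine ⟨m, hm, hmE e (by simp), fun O hO => ?_⟩
    by_contra! hno
    obtain ⟨k1, k2⟩ := nbrs m hm (hmE e (by simp)) O hO hno
    have hobj := hF.1 O hO
    have both : ∀ d d' : V × Fin 3, d.1 = (τ d₁).1 → d'.1 = (τ d₂).1 → (τ d).1 = (τ d').1 →
        ¬ Covers O (τ d).1 := by
      intro d d' hd hd' hdd' hcov
      have m1 := hobj.matched_of_uncovered h hm hno (hd ▸ hD1.1) (hd ▸ k1) hcov
      have m2 := hobj.matched_of_uncovered h hm hno (hd' ▸ hD2.1) (hd' ▸ k2) (hdd' ▸ hcov)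
      have m3 := (hm d (hd ▸ hD1.1) m1).eq (hm d' (hd' ▸ hD2.1) m2) hdd'
      have m4 := h.inj (hd ▸ hD1.1) (hd' ▸ hD2.1) m3
      exact npq (by rw [← hd, m4, hd'])
    have k3 := both f g' hf hg' (hfr.trans hgr.symm)
    have k4 := both f' g hf' hg (hfs.trans hgs.symm)
    rw [hfr] at k3
    rw [hfs] at k4
    refine hobj.false_of_covers_only h hc hS2 (w := (τ e).1) fun v hv hcov => ?_
    rcases mem v hv with rfl | rfl | rfl | rfl | rfl | rfl
    · exact (hz O hO hcov).elim
    · rfl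
    all_goals contradiction

theorem good_of_edgeConn3 (S : Finset V) (τ : V × Fin 3 → V × Fin 3) (h : IsCubicMap S τ)
    (hc : EdgeConn3 S τ) : Good S τ := by
  induction hn : S.card using Nat.strong_induction_on generalizing S τ with
  | _ n ih =>
    have IH : ∀ (S' : Finset V) τ', S'.card < S.card → IsCubicMap S' τ' → EdgeConn3 S' τ' →
        Good S' τ' := fun S' τ' hlt h' hc' => ih _ (hn ▸ hlt) S' τ' h' hc' rfl
    by_cases h3 : ∃ X ⊆ S, (cut τ X).card = 3 ∧ 2 ≤ X.card ∧ 2 ≤ (S \ X).card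
    · obtain ⟨X, hX, hcut, h1, h2⟩ := h3
      exact good_of_three_cut h hc hX hcut h1 h2 IH
    have hnc : ∀ X ⊆ S, (cut τ X).card = 3 → X.card ≤ 1 ∨ (S \ X).card ≤ 1 := by
      intro X hX hcut
      by_contra hno
      exact h3 ⟨X, hX, hcut, by omega, by omega⟩
    by_cases h4 : ∃ X ⊆ S, (cut τ X).card = 4 ∧ 3 ≤ X.card ∧ 3 ≤ (S \ X).card
    · obtain ⟨X, hX, hcut, h1, h2⟩ := h4
      exact good_of_four_cut h hc hX hcut h1 h2 hnc IH
    have hT : Tight S τ := by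
      intro X hX hcut
      by_contra hno
      have h5 := hc X hX (Finset.card_pos.1 (by omega)) (by rintro rfl; simp at hno)
      rcases (show (cut τ X).card = 3 ∨ (cut τ X).card = 4 by omega) with h6 | h6
      · have := hnc X hX h6
        omega
      · exact h4 ⟨X, hX, h6, by omega, by omega⟩
    by_cases h7 : S.card ≤ 6
    · exact good_of_card_le_six h hc hT h7
    · exact good_of_tight h hc hT (by omega) IH

/-- The reversal of darts of a cubic simple graph whose neighbourhoods are enumerated by `φ`. -/
noncomputable def dartRev {G : SimpleGraph V} (φ : ∀ v, Fin 3 ≃ G.neighborSet v)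
    (d : V × Fin 3) : V × Fin 3 :=
  (φ d.1 d.2, (φ (φ d.1 d.2)).symm ⟨d.1, (φ d.1 d.2).2.symm⟩)

section dartRev

variable {G : SimpleGraph V} (φ : ∀ v, Fin 3 ≃ G.neighborSet v)

lemma adj_dartRev (d : V × Fin 3) : G.Adj d.1 (dartRev φ d).1 := (φ d.1 d.2).2

lemma dartRev_ext {d d' : V × Fin 3} (h : d.1 = d'.1) (h' : (dartRev φ d).1 = (dartRev φ d').1) :
    d = d' := by
  obtain ⟨v, i⟩ := d
  obtain ⟨w, j⟩ := d'
  obtain rfl : v = w := h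
  exact Prod.ext rfl ((φ v).injective (Subtype.ext h'))

lemma dartRev_dartRev (d : V × Fin 3) : dartRev φ (dartRev φ d) = d := by
  have key : ∀ d, (dartRev φ (dartRev φ d)).1 = d.1 := by
    intro d
    change ((φ (φ d.1 d.2)) ((φ (φ d.1 d.2)).symm ⟨d.1, _⟩) : V) = d.1
    rw [Equiv.apply_symm_apply]
  exact dartRev_ext φ (key d) (key _)

lemma exists_dart_of_adj {v w : V} (h : G.Adj v w) : ∃ i, (dartRev φ (v, i)).1 = w :=
  ⟨(φ v).symm ⟨w, h⟩, by simp [dartRev]⟩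

lemma isCubicMap_dartRev [Fintype V] : IsCubicMap univ (dartRev φ) := fun d _ =>
  ⟨mem_univ _, dartRev_dartRev φ d, fun h => (adj_dartRev φ d).ne (by rw [h])⟩

lemma edgeConn3_dartRev [Fintype V] (hconn : KConnected 3 G) : EdgeConn3 univ (dartRev φ) := by
  intro X _ hX hXu
  by_contra! hcut
  set T := (cut (dartRev φ) X).image Prod.fst
  have hTc : T.card ≤ 2 := Finset.card_image_le.trans (by omega)
  have hTX : T ⊆ X := by
    intro v hv
    obtain ⟨d, hd, rfl⟩ := Finset.mem_image.1 hv
    exact (mem_cut.1 hd).1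
  by_cases hXT : X ⊆ T
  · have hXc : X.card ≤ 2 := (Finset.card_le_card hXT).trans hTc
    have h1 := Finset.card_filter_add_card_filter_not (s := X ×ˢ (univ : Finset (Fin 3)))
      (fun d => (dartRev φ d).1 ∉ X)
    have h2 : ((X ×ˢ (univ : Finset (Fin 3))).filter fun d => ¬ (dartRev φ d).1 ∉ X).card ≤
        X.offDiag.card := by
      refine Finset.card_le_card_of_injOn (fun d => (d.1, (dartRev φ d).1)) ?_ ?_
      · intro d hd
        have := (adj_dartRev φ d).ne
        simp at hd
        simp [hd, this]
      · intro d _ d' _ hdd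
        simp only [Prod.mk.injEq] at hdd
        exact dartRev_ext φ hdd.1 hdd.2
    rw [Finset.offDiag_card] at h2
    rw [Finset.card_product, Finset.card_univ, Fintype.card_fin] at h1
    change (cut (dartRev φ) X).card + _ = _ at h1
    have h3 := hX.card_pos
    interval_cases X.card <;> omega
  · obtain ⟨a, haX, haT⟩ := Finset.not_subset.1 hXT
    obtain ⟨b, hb⟩ : ∃ b, b ∉ X := by
      by_contra! h
      exact hXu (Finset.eq_univ_iff_forall.2 h)
    have hc := hconn.2 (T : Set V) (by rw [Set.ncard_coe_finset]; omega)
    obtain ⟨p⟩ := hc.preconnected ⟨a, by simpa using haT⟩ ⟨b, fun h => hb (hTX (by simpa using h))⟩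
    have key : ∀ {u w : ((T : Set V)ᶜ : Set V)}, (G.induce (T : Set V)ᶜ).Walk u w →
        u.1 ∈ X → w.1 ∈ X := by
      intro u w p
      induction p with
      | nil => exact id
      | @cons u u' _ huu _ ih =>
        intro hu
        refine ih ?_
        obtain ⟨i, hi⟩ := exists_dart_of_adj φ (show G.Adj u.1 u'.1 from huu)
        by_contra hu'
        refine u.2 ?_
        exact Finset.mem_coe.2 (Finset.mem_image.2
          ⟨(u.1, i), mem_cut.2 ⟨hu, by rwa [hi]⟩, rfl⟩)
    exact hb (key p haX)

/-- The darts of a subgraph. -/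
def subgraphDarts (O : G.Subgraph) : Set (V × Fin 3) := {d | O.Adj d.1 (dartRev φ d).1}

lemma isObj_subgraphDarts [Fintype V] {O : G.Subgraph} (hO : IsCycleSG O) :
    IsObj univ (dartRev φ) (subgraphDarts φ O) := by
  have two : ∀ v ∈ O.verts, {i | O.Adj v (dartRev φ (v, i)).1}.ncard = 2 := by
    intro v hv
    rw [← hO.2 v hv, sdeg]
    refine Set.ncard_congr (fun i _ => (dartRev φ (v, i)).1) (fun i hi => hi) ?_ ?_
    · intro i j _ _ hij
      exact congrArg Prod.snd (dartRev_ext φ (d := (v, i)) (d' := (v, j)) rfl hij)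
    · intro w hw
      obtain ⟨i, hi⟩ := exists_dart_of_adj φ (O.adj_sub hw)
      exact ⟨i, by rw [Set.mem_ofPred_eq, hi]; exact hw, hi⟩
  refine ⟨?_, fun _ _ => mem_univ _, ?_, ?_⟩
  · obtain ⟨v, hv⟩ := hO.1.nonempty
    have h1 := two v hv
    obtain ⟨i, hi⟩ := (Set.ncard_pos (Set.toFinite _)).1 (by rw [h1]; norm_num)
    exact ⟨(v, i), hi⟩
  · intro d hd
    change O.Adj (dartRev φ d).1 (dartRev φ (dartRev φ d)).1
    rw [dartRev_dartRev]
    exact O.adj_symm hd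
  · intro v
    by_cases hv : v ∈ O.verts
    · right
      have h1 := two v hv
      have h2 := Set.ncard_add_ncard_compl {i | O.Adj v (dartRev φ (v, i)).1}
      rw [h1, Nat.card_eq_fintype_card, Fintype.card_fin] at h2
      obtain ⟨k, hk⟩ := Set.ncard_eq_one.1
        (show {i | O.Adj v (dartRev φ (v, i)).1}ᶜ.ncard = 1 by omega)
      refine ⟨k, fun i => ?_⟩
      have h3 : i ∈ {i | O.Adj v (dartRev φ (v, i)).1}ᶜ ↔ i ∈ ({k} : Set (Fin 3)) := by rw [hk]
      rw [Set.mem_compl_iff, Set.mem_singleton_iff] at h3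
      exact (not_iff_comm.1 h3).symm.trans Iff.rfl
    · left
      exact fun i hi => hv (O.edge_vert hi)

lemma disjoint_subgraphDarts {O O' : G.Subgraph} (h : Disjoint O.edgeSet O'.edgeSet) :
    Disjoint (subgraphDarts φ O) (subgraphDarts φ O') := by
  rw [Set.disjoint_left] at h ⊢
  exact fun d hd hd' => h (a := s(d.1, (dartRev φ d).1)) hd hd'

/-- The perfect matching given by a selection of darts. -/
noncomputable def matchingSubgraph [Fintype V] {m : V → Fin 3} (hm : IsPM univ (dartRev φ) m) :
    G.Subgraph where
  verts := Set.univ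
  Adj v w := (dartRev φ (v, m v)).1 = w
  adj_sub := by
    rintro v w rfl
    exact adj_dartRev φ (v, m v)
  edge_vert _ := Set.mem_univ _
  symm := by
    constructor
    rintro v w rfl
    have h : m (dartRev φ (v, m v)).1 = (dartRev φ (v, m v)).2 := hm (v, m v) (mem_univ _) rfl
    rw [h, Prod.mk.eta, dartRev_dartRev]

lemma isTFactor_matchingSubgraph [Fintype V] {m : V → Fin 3} (hm : IsPM univ (dartRev φ) m) :
    IsTFactor (matchingSubgraph φ hm) 1 := by
  refine ⟨fun v => Set.mem_univ v, fun v => Set.ncard_eq_one.2 ⟨(dartRev φ (v, m v)).1, ?_⟩⟩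
  ext w
  exact eq_comm

end dartRev

end CubicDarts

/-- Kardoš–Máčajová–Zerafa: in a 3-connected cubic graph, for any set of pairwise
edge-disjoint cycles there is a perfect matching meeting every cycle of the set. -/
theorem stmt_8 {V : Type*} [Fintype V] (G : SimpleGraph V)
    (hconn : KConnected 3 G) (hreg : IsRegular G 3)
    (𝒪 : Set G.Subgraph) (hcyc : ∀ O ∈ 𝒪, IsCycleSG O)
    (hdisj : PairwiseEdgeDisjoint 𝒪) :
    ∃ F : G.Subgraph, IsTFactor F 1 ∧
      ∀ O ∈ 𝒪, (F.edgeSet ∩ O.edgeSet).Nonempty := by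
  obtain ⟨φ⟩ : Nonempty (∀ v, Fin 3 ≃ G.neighborSet v) :=
    ⟨fun v => (Finite.equivFinOfCardEq (hreg v)).symm⟩
  have hgood := good_of_edgeConn3 Finset.univ _ (isCubicMap_dartRev φ) (edgeConn3_dartRev φ hconn)
  have hF : ∀ 𝒬 ⊆ 𝒪, IsFamily Finset.univ (dartRev φ) (subgraphDarts φ '' 𝒬) := by
    refine fun 𝒬 hP => ⟨?_, ?_⟩
    · rintro _ ⟨O, hO, rfl⟩
      exact isObj_subgraphDarts φ (hcyc O (hP hO))
    · rintro _ ⟨O, hO, rfl⟩ _ ⟨O', hO', rfl⟩ hne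
      exact disjoint_subgraphDarts φ (hdisj (hP hO) (hP hO') fun h => hne (by rw [h]))
  have meets : ∀ {m} (hm : IsPM Finset.univ (dartRev φ) m) (O : G.Subgraph),
      (∃ d ∈ subgraphDarts φ O, Matched m d) →
        ((matchingSubgraph φ hm).edgeSet ∩ O.edgeSet).Nonempty := by
    rintro m hm O ⟨d, hd, hdm⟩
    refine ⟨s(d.1, (dartRev φ d).1), ?_, hd⟩
    change (dartRev φ (d.1, m d.1)).1 = (dartRev φ d).1
    rw [show m d.1 = d.2 from hdm]
  rcases 𝒪.eq_empty_or_nonempty with rfl | ⟨O₀, hO₀⟩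
  · have : Nonempty V := Fintype.card_pos_iff.1 (by have := hconn.1; omega)
    obtain ⟨m, hm, -⟩ := hgood ∅ (by simpa using hF ∅ le_rfl) (Classical.arbitrary V, 0)
      (Finset.mem_univ _) (by simp)
    exact ⟨_, isTFactor_matchingSubgraph φ hm, by simp⟩
  · obtain ⟨⟨e, he⟩, -⟩ := isObj_subgraphDarts φ (hcyc O₀ hO₀)
    obtain ⟨m, hm, hme, hmO⟩ := hgood (subgraphDarts φ '' (𝒪 \ {O₀})) (hF _ Set.sdiff_subset) e
      (Finset.mem_univ _) (by
        rintro _ ⟨O, ⟨hO, hne⟩, rfl⟩ i hi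
        have h1 := (hF 𝒪 le_rfl).eq_of_mem (Set.mem_image_of_mem _ hO)
          (Set.mem_image_of_mem _ hO₀) hi (j := e.2) he
        have h2 := disjoint_subgraphDarts φ (hdisj hO hO₀ hne)
        exact Set.disjoint_left.1 h2 (h1 ▸ he) he)
    refine ⟨_, isTFactor_matchingSubgraph φ hm, fun O hO => meets hm O ?_⟩
    by_cases h : O = O₀
    · exact h ▸ ⟨e, he, hme⟩
    · exact hmO _ ⟨O, ⟨hO, h⟩, rfl⟩

end PaperFormalization
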